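/- arXiv:1506.07052 — 2 statements merged into one kernel-verified Lean document; each statement's English description precedes it below -/
import Mathlib

section
/- Let R be a commutative noetherian ring, a ⊊ R a proper ideal, and M an a-adically semidualizing R-module. Then for every ideal b ⊇ a with b ≠ R, and for every p ∈ V(a), the localization M_p is an a_p-adically semidualizing R_p-module, provided M is a-adically finite; in particular, the a-adic semidualizing property of a module can be checked at all maximal ideals containing a: M is a-adically semidualizing over R if and only if M_m is a_m-adically semidualizing over R_m for every maximal ideal m ⊇ a. -/
open CategoryTheory

noncomputable section
universe u

/-- `Ext^i_R(M, N)`. -/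
abbrev extMod (R : Type u) [CommRing R] (i : ℕ) (M N : Type u) [AddCommGroup M] [Module R M]
    [AddCommGroup N] [Module R N] : ModuleCat R :=
  ((Ext R (ModuleCat.{u} R) i).obj (Opposite.op (ModuleCat.of R M))).obj (ModuleCat.of R N)

/-- `M` is `a`-torsion: every element is annihilated by a power of `a`. -/
def IsAdicTorsion (R : Type u) [CommRing R] (a : Ideal R) (M : Type u)
    [AddCommGroup M] [Module R M] : Prop :=
  ∀ x : M, ∃ n : ℕ, ∀ r ∈ a ^ n, r • x = 0

/-- `M` is `a`-adically semidualizing over `R`. -/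
def IsAdicSemidualizing (R : Type u) [CommRing R] (a : Ideal R) (M : Type u)
    [AddCommGroup M] [Module R M] : Prop :=
  IsAdicTorsion R a M ∧
  (∀ i : ℕ, Module.Finite R (extMod R i (R ⧸ a) M)) ∧
  (∃ χ : AdicCompletion a R →ₐ[R] Module.End R M, Function.Bijective χ) ∧
  ∀ i : ℕ, 1 ≤ i → Subsingleton (extMod R i M M)

/-- The localized statement at a prime `p ⊇ a`:  `M_p` is `a_p`-adically semidualizing over
`R_p`. -/
def IsAdicSemidualizingLocalizedAt (R : Type u) [CommRing R] (a : Ideal R) (M : Type u)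
    [AddCommGroup M] [Module R M] (p : Ideal R) (hp : p.IsPrime) : Prop :=
  letI := hp
  IsAdicSemidualizing (Localization.AtPrime p)
    (a.map (algebraMap R (Localization.AtPrime p)))
    (LocalizedModule p.primeCompl M)


namespace ASL

section ModuleLemmas

variable {A : Type*} [CommRing A]

/-- the telescope operator. -/
def tel (x : A) (H : Type*) [AddCommGroup H] [Module A H] : (ℕ → H) →ₗ[A] (ℕ → H) where
  toFun f n := f n - x • f (n + 1)
  map_add' f g := by ext n; simp [smul_add]; abel
  map_smul' r f := by
    ext n
    simp only [Pi.smul_apply, RingHom.id_apply, smul_sub, smul_comm x r]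

/-- derived completeness with respect to one element. -/
def DC (x : A) (H : Type*) [AddCommGroup H] [Module A H] : Prop :=
  Function.Bijective (tel x H)

variable {H₁ H₂ H₃ H₄ H₅ : Type*} [AddCommGroup H₁] [Module A H₁] [AddCommGroup H₂] [Module A H₂]
  [AddCommGroup H₃] [Module A H₃] [AddCommGroup H₄] [Module A H₄] [AddCommGroup H₅] [Module A H₅]

lemma exact_compLeft {f : H₁ →ₗ[A] H₂} {g : H₂ →ₗ[A] H₃} (h : Function.Exact f g) :
    Function.Exact (f.compLeft ℕ) (g.compLeft ℕ) := by
  intro y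
  constructor
  · intro hy
    have : ∀ n, ∃ z, f z = y n := fun n => (h (y n)).1 (congrFun hy n)
    choose z hz using this
    exact ⟨z, funext hz⟩
  · rintro ⟨z, rfl⟩
    ext n
    simpa using h.apply_apply_eq_zero (z n)

lemma tel_comm (x : A) (f : H₁ →ₗ[A] H₂) :
    (f.compLeft ℕ) ∘ₗ tel x H₁ = tel x H₂ ∘ₗ (f.compLeft ℕ) := by
  ext h n
  simp [tel]

lemma DC.five (x : A) (f₁ : H₁ →ₗ[A] H₂) (f₂ : H₂ →ₗ[A] H₃) (f₃ : H₃ →ₗ[A] H₄)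
    (f₄ : H₄ →ₗ[A] H₅) (e₁ : Function.Exact f₁ f₂) (e₂ : Function.Exact f₂ f₃)
    (e₃ : Function.Exact f₃ f₄) (h₁ : DC x H₁) (h₂ : DC x H₂) (h₄ : DC x H₄) (h₅ : DC x H₅) :
    DC x H₃ :=
  LinearMap.bijective_of_surjective_of_bijective_of_bijective_of_injective
    (f₁.compLeft ℕ) (f₂.compLeft ℕ) (f₃.compLeft ℕ) (f₄.compLeft ℕ)
    (f₁.compLeft ℕ) (f₂.compLeft ℕ) (f₃.compLeft ℕ) (f₄.compLeft ℕ)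
    (tel x H₁) (tel x H₂) (tel x H₃) (tel x H₄) (tel x H₅)
    (tel_comm x f₁) (tel_comm x f₂) (tel_comm x f₃) (tel_comm x f₄)
    (exact_compLeft e₁) (exact_compLeft e₂) (exact_compLeft e₃)
    (exact_compLeft e₁) (exact_compLeft e₂) (exact_compLeft e₃)
    h₁.2 h₂ h₄ h₅.1

lemma DC.of_subsingleton (x : A) [Subsingleton H₁] : DC x H₁ :=
  ⟨fun _ _ _ => Subsingleton.elim _ _, fun y => ⟨0, Subsingleton.elim _ _⟩⟩

lemma DC.of_equiv {x : A} (e : H₁ ≃ₗ[A] H₂) (h : DC x H₁) : DC x H₂ := by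
  haveI : Subsingleton PUnit.{1} := inferInstance
  refine DC.five x (0 : PUnit.{1} →ₗ[A] H₁) e.toLinearMap (0 : H₂ →ₗ[A] PUnit.{1})
    (0 : PUnit.{1} →ₗ[A] PUnit.{1}) ?_ ?_ ?_ (DC.of_subsingleton x) h (DC.of_subsingleton x)
    (DC.of_subsingleton x)
  · intro y
    constructor
    · intro h; exact ⟨0, by simpa using (e.map_eq_zero_iff.1 h).symm⟩
    · rintro ⟨z, rfl⟩; simp
  · intro y; simp [e.surjective y]
  · intro y; simp [Subsingleton.elim y 0]

lemma DC.eq_zero {x : A} (h : DC x H₁) (hs : ∀ y : H₁, ∃ z : H₁, y = x • z) (y : H₁) : y = 0 := by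
  choose φ hφ using hs
  have : tel x H₁ (fun n => φ^[n] y) = tel x H₁ 0 := by
    ext n
    simp only [tel, LinearMap.coe_mk, AddHom.coe_mk, Function.iterate_succ_apply', ← hφ]
    simp
  exact congrFun (h.1 this) 0

/-- Hom from an `x`-torsion module is derived complete. -/
lemma DC.hom {x : A} {M N : Type*} [AddCommGroup M] [Module A M] [AddCommGroup N] [Module A N]
    (hM : ∀ m : M, ∃ k : ℕ, x ^ k • m = 0) : DC x (M →ₗ[A] N) := by
  constructor
  · rw [← LinearMap.ker_eq_bot, LinearMap.ker_eq_bot']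
    intro f hf
    have h1 : ∀ n, f n = x • f (n + 1) := fun n => sub_eq_zero.1 (congrFun hf n)
    have h2 : ∀ k n, f n = x ^ k • f (n + k) := by
      intro k
      induction k with
      | zero => intro n; simp
      | succ k ih => intro n; rw [ih n, h1 (n + k), pow_succ, mul_smul]; rfl
    ext n m
    obtain ⟨k, hk⟩ := hM m
    rw [h2 k n]
    simp only [LinearMap.smul_apply, ← map_smul, hk, map_zero]
    rfl
  · intro g
    let s : ℕ → M → ℕ → N := fun n m K => ∑ k ∈ Finset.range K, g (n + k) (x ^ k • m)
    have hst : ∀ n m K, x ^ K • m = 0 → ∀ L, K ≤ L → s n m L = s n m K := by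
      intro n m K hK L hL
      refine (Finset.sum_subset (Finset.range_mono hL) ?_).symm
      intro k _ hk
      have : K ≤ k := by simpa using hk
      obtain ⟨j, rfl⟩ := Nat.exists_eq_add_of_le this
      rw [add_comm K j, pow_add, mul_smul, hK]; simp
    choose K hK using hM
    have key : ∀ n m L, x ^ L • m = 0 → s n m L = s n m (K m) := by
      intro n m L hL
      rcases le_total L (K m) with h | h
      · exact (hst n m L hL _ h).symm
      · exact hst n m _ (hK m) _ h
    have hbig : ∀ (m : M) (L : ℕ), K m ≤ L → x ^ L • m = 0 := by
      intro m L hL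
      obtain ⟨j, rfl⟩ := Nat.exists_eq_add_of_le hL
      rw [add_comm (K m) j, pow_add, mul_smul, hK, smul_zero]
    let f : ℕ → M →ₗ[A] N := fun n =>
      { toFun := fun m => s n m (K m)
        map_add' := by
          intro a b
          have ha := hbig a (max (K a) (K b)) (le_max_left _ _)
          have hb := hbig b (max (K a) (K b)) (le_max_right _ _)
          rw [← key n (a + b) (max (K a) (K b)) (by rw [smul_add, ha, hb, add_zero]),
            ← key n a _ ha, ← key n b _ hb]
          simp [s, Finset.sum_add_distrib]
        map_smul' := by
          intro r a
          rw [← key n (r • a) (K a) (by rw [smul_comm, hK, smul_zero])]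
          simp only [s, RingHom.id_apply, Finset.smul_sum]
          refine Finset.sum_congr rfl fun k _ => ?_
          rw [smul_comm, map_smul] }
    refine ⟨f, ?_⟩
    ext n m
    have h1 : f n m = s n m (K m + 1) := (key n m _ (hbig m _ (by omega))).symm
    have h2 : f (n + 1) (x • m) = s (n + 1) (x • m) (K m) :=
      (key (n + 1) (x • m) (K m) (by rw [smul_comm, hK, smul_zero])).symm
    have h3 : tel x (M →ₗ[A] N) f n m = f n m - f (n + 1) (x • m) := by simp [tel]
    rw [h3, h1, h2]
    simp only [s, Finset.sum_range_succ' _ (K m), ← mul_smul, ← pow_succ]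
    simp [add_assoc, add_comm 1]

/-- A module killed by `a^k` whose `a`-socle is finite is finite (noetherian). -/
lemma finite_of_socle [IsNoetherianRing A] (a : Ideal A) {N : Type*} [AddCommGroup N] [Module A N]
    (S : Submodule A N) (hS : ∀ n : N, (∀ r ∈ a, r • n = 0) → n ∈ S) (hf : Module.Finite A S)
    (k : ℕ) (hk : ∀ r ∈ a ^ k, ∀ n : N, r • n = 0) : Module.Finite A N := by
  obtain ⟨s, hs⟩ := (IsNoetherian.noetherian a : a.FG)
  let W : ℕ → Submodule A N := fun j =>
    { carrier := {n | ∀ r ∈ a ^ j, r • n = 0}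
      add_mem' := by intro p q hp hq r hr; rw [smul_add, hp r hr, hq r hr, add_zero]
      zero_mem' := by intro r _; simp
      smul_mem' := by intro c p hp r hr; rw [smul_comm, hp r hr, smul_zero] }
  have hW : ∀ j, Module.Finite A (W j) := by
    intro j
    induction j with
    | zero =>
      have : Subsingleton (W 0) := by
        refine ⟨fun p q => ?_⟩
        have hp := p.2 1 (by simp)
        have hq := q.2 1 (by simp)
        ext
        simpa using (show (1:A) • (p : N) = (1:A) • (q : N) by rw [hp, hq])
      infer_instance
    | succ j ih =>
      let φ : W (j + 1) →ₗ[A] (s → W j) := LinearMap.pi fun x =>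
        { toFun := fun n => ⟨(x : A) • (n : N), by
            intro r hr
            rw [← mul_smul]
            refine n.2 _ ?_
            rw [pow_succ]
            refine Ideal.mul_mem_mul hr ?_
            rw [← hs]; exact Submodule.subset_span x.2⟩
          map_add' := by intro p q; ext; simp
          map_smul' := by intro r p; ext; exact smul_comm _ _ _ }
      have hker : ∀ n : LinearMap.ker φ, ((n : W (j + 1)) : N) ∈ S := by
        intro n
        apply hS
        intro r hr
        rw [← hs] at hr
        have h0 : ∀ x ∈ s, x • ((n : W (j + 1)) : N) = 0 := by
          intro x hx
          have := congrFun (LinearMap.mem_ker.1 n.2) ⟨x, hx⟩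
          exact congrArg Subtype.val this
        refine Submodule.span_induction (p := fun r _ => r • ((n : W (j + 1)) : N) = 0) ?_ ?_ ?_ ?_ hr
        · intro x hx; exact h0 x hx
        · simp
        · intro p q _ _ hp hq; rw [add_smul, hp, hq, add_zero]
        · intro c p _ hp; rw [smul_assoc, hp, smul_zero]
      have hkf : Module.Finite A (LinearMap.ker φ) := by
        let ψ : LinearMap.ker φ →ₗ[A] S :=
          ((W (j+1)).subtype ∘ₗ (LinearMap.ker φ).subtype).codRestrict S hker
        refine Module.Finite.of_injective ψ ?_
        intro p q h
        have := congrArg Subtype.val h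
        exact Subtype.ext (Subtype.ext this)
      have hr : Module.Finite A (LinearMap.range φ) := inferInstance
      refine ⟨Submodule.fg_of_fg_map_of_fg_inf_ker φ ?_ ?_⟩
      · rw [← LinearMap.range_eq_map]; exact Module.Finite.iff_fg.1 hr
      · rw [top_inf_eq]; exact Module.Finite.iff_fg.1 hkf
  have := hW k
  refine Module.Finite.of_surjective (W k).subtype ?_
  intro n
  exact ⟨⟨n, fun r hr => hk r hr n⟩, rfl⟩

end ModuleLemmas

section Towers
set_option linter.unusedSectionVars false
set_option linter.unusedVariables false

open CategoryTheory.Pretriangulated CategoryTheory.Limits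

variable {A : Type*} [CommRing A] {C : Type*} [Category C] [Preadditive C] [HasZeroObject C]
  [HasShift C ℤ] [∀ n : ℤ, (shiftFunctor C n).Additive] [Pretriangulated C] [Linear A C]

lemma exact_yo (T : Triangle C) (hT : T ∈ distTriang C) (Z : C) :
    Function.Exact (Linear.leftComp A Z T.mor₂) (Linear.leftComp A Z T.mor₁) := by
  intro f
  constructor
  · intro hf
    obtain ⟨g, hg⟩ := Triangle.yoneda_exact₂ T hT f hf
    exact ⟨g, hg.symm⟩
  · rintro ⟨g, rfl⟩
    simp [comp_distTriang_mor_zero₁₂_assoc _ hT]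

lemma exact_coyo (T : Triangle C) (hT : T ∈ distTriang C) (Z : C) :
    Function.Exact (Linear.rightComp A Z T.mor₁) (Linear.rightComp A Z T.mor₂) := by
  intro f
  constructor
  · intro hf
    obtain ⟨g, hg⟩ := Triangle.coyoneda_exact₂ T hT f hf
    exact ⟨g, hg.symm⟩
  · rintro ⟨g, rfl⟩
    simp [comp_distTriang_mor_zero₁₂ _ hT]

/-- closure of a predicate along shifted triangles. -/
lemma closure_shift (p : C → Prop) (iso : ∀ {X X' : C}, (X ≅ X') → p X → p X')
    (step : ∀ T ∈ distTriang C, p (T.obj₁⟦(1 : ℤ)⟧) → p T.obj₃ → p T.obj₁ →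
      p (T.obj₃⟦(-1 : ℤ)⟧) → p T.obj₂)
    (T : Triangle C) (hT : T ∈ distTriang C) (h₁ : ∀ n : ℤ, p (T.obj₁⟦n⟧))
    (h₃ : ∀ n : ℤ, p (T.obj₃⟦n⟧)) (n : ℤ) : p (T.obj₂⟦n⟧) := by
  refine step _ (Triangle.shift_distinguished T hT n) ?_ (h₃ n) (h₁ n) ?_
  · exact iso ((shiftFunctorAdd' C n 1 (n + 1) rfl).app _) (h₁ _)
  · exact iso ((shiftFunctorAdd' C n (-1) (n + -1) rfl).app _) (h₃ _)

lemma closure_shift_one (p : C → Prop) (iso : ∀ {X X' : C}, (X ≅ X') → p X → p X')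
    (step : ∀ T ∈ distTriang C, p (T.obj₁⟦(1 : ℤ)⟧) → p T.obj₃ → p T.obj₁ →
      p (T.obj₃⟦(-1 : ℤ)⟧) → p T.obj₂)
    (T : Triangle C) (hT : T ∈ distTriang C) (h₂ : ∀ n : ℤ, p (T.obj₂⟦n⟧))
    (h₃ : ∀ n : ℤ, p (T.obj₃⟦n⟧)) (n : ℤ) : p (T.obj₁⟦n⟧) := by
  refine closure_shift p iso step T.invRotate (inv_rot_of_distTriang _ hT) ?_ h₂ n
  intro k
  exact iso ((shiftFunctorAdd' C (-1) k (-1 + k) rfl).app _) (h₃ _)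

lemma DC_iso (x : A) (Z : C) {X X' : C} (e : X ≅ X') (h : DC x (X ⟶ Z)) : DC x (X' ⟶ Z) :=
  h.of_equiv (Linear.homCongr A e (Iso.refl Z))

lemma DC_step (x : A) (Z : C) (T : Triangle C) (hT : T ∈ distTriang C)
    (h1 : DC x (T.obj₁⟦(1 : ℤ)⟧ ⟶ Z)) (h2 : DC x (T.obj₃ ⟶ Z)) (h3 : DC x (T.obj₁ ⟶ Z))
    (h4 : DC x (T.obj₃⟦(-1 : ℤ)⟧ ⟶ Z)) : DC x (T.obj₂ ⟶ Z) :=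
  DC.five x (Linear.leftComp A Z T.mor₃) (Linear.leftComp A Z T.mor₂) (Linear.leftComp A Z T.mor₁)
    (Linear.leftComp A Z T.invRotate.mor₁) (exact_yo _ (rot_of_distTriang _ hT) Z)
    (exact_yo _ hT Z) (exact_yo _ (inv_rot_of_distTriang _ hT) Z) h1 h2 h3 h4

lemma fin_mid [IsNoetherianRing A] {H₁ H₂ H₃ : Type*} [AddCommGroup H₁] [Module A H₁]
    [AddCommGroup H₂] [Module A H₂] [AddCommGroup H₃] [Module A H₃]
    (f : H₁ →ₗ[A] H₂) (g : H₂ →ₗ[A] H₃) (h : Function.Exact f g)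
    (h1 : Module.Finite A H₁) (h3 : Module.Finite A H₃) : Module.Finite A H₂ := by
  have hr : Module.Finite A (LinearMap.range g) := inferInstance
  have hk : Module.Finite A (LinearMap.range f) := inferInstance
  refine ⟨Submodule.fg_of_fg_map_of_fg_inf_ker g ?_ ?_⟩
  · rw [← LinearMap.range_eq_map]; exact Module.Finite.iff_fg.1 hr
  · rw [top_inf_eq, LinearMap.exact_iff.1 h]; exact Module.Finite.iff_fg.1 hk

lemma fin_iso (W : C) {X X' : C} (e : X ≅ X') (h : Module.Finite A (W ⟶ X)) :
    Module.Finite A (W ⟶ X') :=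
  Module.Finite.equiv (Linear.homCongr A (Iso.refl W) e)

lemma fin_step [IsNoetherianRing A] (W : C) (T : Triangle C) (hT : T ∈ distTriang C)
    (h2 : Module.Finite A (W ⟶ T.obj₃)) (h3 : Module.Finite A (W ⟶ T.obj₁)) :
    Module.Finite A (W ⟶ T.obj₂) :=
  fin_mid _ _ (exact_coyo T hT W) h3 h2

variable (A) in
/-- iterated fibres of multiplications. -/
inductive Tower (Y : C) : List A → (X : C) → (X ⟶ Y) → Prop
  | nil : Tower Y [] Y (𝟙 Y)
  | cons {x : A} {xs : List A} {X X' : C} {π : X ⟶ Y} (g : X' ⟶ X) (h : X ⟶ X'⟦(1 : ℤ)⟧)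
      (ht : Tower Y xs X π) (hT : Triangle.mk g (x • 𝟙 X) h ∈ distTriang C) :
      Tower Y (x :: xs) X' (g ≫ π)

lemma Tower.exists (Y : C) (xs : List A) : ∃ (X : C) (π : X ⟶ Y), Tower A Y xs X π := by
  induction xs with
  | nil => exact ⟨_, _, Tower.nil⟩
  | cons x xs ih =>
    obtain ⟨X, π, h⟩ := ih
    obtain ⟨X', g, f, hT⟩ := distinguished_cocone_triangle₁ (x • 𝟙 X)
    exact ⟨X', _, Tower.cons g f h hT⟩

lemma Tower.closed {Y : C} (p : C → Prop) (iso : ∀ {X X' : C}, (X ≅ X') → p X → p X')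
    (step : ∀ T ∈ distTriang C, p (T.obj₁⟦(1 : ℤ)⟧) → p T.obj₃ → p T.obj₁ →
      p (T.obj₃⟦(-1 : ℤ)⟧) → p T.obj₂) (hY : ∀ n : ℤ, p (Y⟦n⟧)) {xs : List A} {X : C} {π : X ⟶ Y}
    (h : Tower A Y xs X π) : ∀ n : ℤ, p (X⟦n⟧) := by
  induction h with
  | nil => exact hY
  | cons g f ht hT ih => exact closure_shift_one p iso step _ hT ih ih

/-- vanishing in positive degrees. -/
def Van (Y X : C) : Prop := ∀ m : ℤ, 0 < m → ∀ f : X⟦-m⟧ ⟶ Y, f = 0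

lemma van_iso {Y X : C} (hv : Van Y X) (k : ℤ) (hk : k < 0) {Z : C} (e : X⟦k⟧ ≅ Z) (f : Z ⟶ Y) :
    f = 0 := by
  obtain ⟨m, rfl⟩ : ∃ m, k = -m := ⟨-k, by simp⟩
  have := hv m (by omega) (e.hom ≫ f)
  simpa using this

lemma Van.cons {Y X X' : C} {x : A} {g : X' ⟶ X} {h : X ⟶ X'⟦(1 : ℤ)⟧}
    (hT : Triangle.mk g (x • 𝟙 X) h ∈ distTriang C) (hv : Van Y X) : Van Y X' := by
  intro m hm f
  have hT' := Triangle.shift_distinguished _ (inv_rot_of_distTriang _ hT) (-m)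
  have h1 := Triangle.yoneda_exact₂ _ hT' f
    (van_iso hv (-1 + -m) (by omega) ((shiftFunctorAdd' C (-1) (-m) (-1 + -m) rfl).app _) _)
  obtain ⟨g', hg⟩ := h1
  have h0 : g' = 0 := van_iso hv (-m) (by omega) (Iso.refl _) g'
  rw [h0] at hg
  exact hg.trans comp_zero

lemma Van.of_cons [∀ n : ℤ, (shiftFunctor C n).Linear A] {Y X X' : C} {x : A} {g : X' ⟶ X}
    {h : X ⟶ X'⟦(1 : ℤ)⟧}
    (hT : Triangle.mk g (x • 𝟙 X) h ∈ distTriang C) (hd : ∀ n : ℤ, DC x (X⟦n⟧ ⟶ Y))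
    (hv : Van Y X') : Van Y X := by
  intro m hm f
  refine DC.eq_zero (hd (-m)) ?_ f
  intro y
  obtain ⟨z, hz⟩ : ∃ z : X⟦-m⟧ ⟶ Y,
      y = ((-m).negOnePow • (shiftFunctor C (-m)).map (x • 𝟙 X)) ≫ z :=
    Triangle.yoneda_exact₂ _ (Triangle.shift_distinguished _ hT (-m)) y (hv m hm _)
  refine ⟨(-m).negOnePow • z, ?_⟩
  rw [hz, Functor.map_smul, CategoryTheory.Functor.map_id, Units.smul_def, Units.smul_def,
    Preadditive.zsmul_comp, Linear.smul_comp, Category.id_comp, smul_comm]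


lemma Tower.van {Y X : C} {xs : List A} {π : X ⟶ Y} (h : Tower A Y xs X π) (hv : Van Y Y) :
    Van Y X := by
  induction h with
  | nil => exact hv
  | cons g f ht hT ih => exact ih.cons hT

lemma Tower.van_conv [∀ n : ℤ, (shiftFunctor C n).Linear A] {Y X : C} {xs : List A} {π : X ⟶ Y}
    (h : Tower A Y xs X π)
    (hd : ∀ x ∈ xs, ∀ n : ℤ, DC x (Y⟦n⟧ ⟶ Y)) (hv : Van Y X) : Van Y Y := by
  induction h with
  | nil => exact hv
  | @cons x xs X X' π g f ht hT ih =>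
    refine ih (fun y hy => hd y (by simp [hy])) (Van.of_cons hT ?_ hv)
    exact ht.closed (fun Z => DC x (Z ⟶ Y)) (DC_iso x Y) (DC_step x Y) (hd x (by simp))

/-- `Hom(X, Y)` as quotient of `End Y`. -/
lemma Tower.quot {Y X : C} {xs : List A} {π : X ⟶ Y} (h : Tower A Y xs X π) (hv : Van Y Y) :
    (∀ f : X ⟶ Y, ∃ φ : Y ⟶ Y, f = π ≫ φ) ∧
    ∀ φ : Y ⟶ Y, π ≫ φ = 0 ↔
      φ ∈ (Ideal.span {x | x ∈ xs} • (⊤ : Submodule A (Y ⟶ Y))) := by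
  induction h with
  | nil => simp
  | @cons x xs X X' π g f ht hT ih =>
    have hvX := ht.van hv
    constructor
    · intro q
      obtain ⟨q', hq'⟩ := Triangle.yoneda_exact₂ _ (inv_rot_of_distTriang _ hT) q
        (van_iso hvX (-1) (by omega) (Iso.refl _) _)
      obtain ⟨φ, hφ⟩ := ih.1 q'
      refine ⟨φ, ?_⟩
      rw [hq', hφ, Category.assoc]; rfl
    · intro φ
      have hsp : Ideal.span {y | y ∈ x :: xs} = Ideal.span {x} ⊔ Ideal.span {y | y ∈ xs} := by
        rw [← Ideal.span_union]; congr 1; ext y; simp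
      rw [hsp, Submodule.sup_smul]
      constructor
      · intro hφ
        rw [Category.assoc] at hφ
        obtain ⟨q, hq⟩ : ∃ q : X ⟶ Y, π ≫ φ = (x • 𝟙 X) ≫ q := Triangle.yoneda_exact₂ _ hT (π ≫ φ) hφ
        obtain ⟨ψ, hψ⟩ := ih.1 q
        have h1 : π ≫ (φ - x • ψ) = 0 := by
          rw [Preadditive.comp_sub, Linear.comp_smul, ← hψ]
          have : π ≫ φ = x • q := hq.trans (by simp)
          rw [this, sub_self]
        have h2 := (ih.2 _).1 h1
        have h3 : φ = x • ψ + (φ - x • ψ) := by abel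
        rw [h3]
        refine Submodule.add_mem_sup ?_ h2
        exact Submodule.smul_mem_smul (Ideal.mem_span_singleton_self x) trivial
      · intro hφ
        obtain ⟨φ1, h1, φ2, h2, rfl⟩ := Submodule.mem_sup.1 hφ
        rw [Submodule.ideal_span_singleton_smul] at h1
        obtain ⟨ψ, -, rfl⟩ := h1
        rw [Category.assoc, Preadditive.comp_add, (ih.2 φ2).2 h2, add_zero]
        have h12 : g ≫ (x • 𝟙 X) = 0 := comp_distTriang_mor_zero₁₂ _ hT
        have h12' : x • g = 0 := by rwa [Linear.comp_smul, Category.comp_id] at h12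
        have : g ≫ π ≫ (x • ψ) = (x • g) ≫ π ≫ ψ := by simp
        exact this.trans (by rw [h12', zero_comp])

lemma smul_id_sq [∀ n : ℤ, (shiftFunctor C n).Linear A] {T : Triangle C} (hT : T ∈ distTriang C)
    (s : A) (h1 : s • T.mor₁ = 0) (h2 : s • T.mor₂ = 0) : (s * s) • 𝟙 T.obj₂ = 0 := by
  obtain ⟨u, hu⟩ := Triangle.coyoneda_exact₂ T hT (s • 𝟙 T.obj₂) (by simpa using h2)
  rw [mul_smul, hu, ← Linear.comp_smul, h1, comp_zero]

lemma smul_id_shift [∀ n : ℤ, (shiftFunctor C n).Linear A] {X : C} {s : A} (h : s • 𝟙 X = 0)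
    (n : ℤ) : s • 𝟙 (X⟦n⟧) = 0 := by
  have : (shiftFunctor C n).map (s • 𝟙 X) = 0 := by rw [h, Functor.map_zero]
  simpa [Functor.map_smul] using this

lemma smul_zero_of_id {X Z : C} {s : A} (h : s • 𝟙 X = 0) (f : X ⟶ Z) : s • f = 0 := by
  have : s • f = (s • 𝟙 X) ≫ f := by simp
  rw [this, h, zero_comp]

lemma smul_zero_of_id' {X Z : C} {s : A} (h : s • 𝟙 Z = 0) (f : X ⟶ Z) : s • f = 0 := by
  have : s • f = f ≫ (s • 𝟙 Z) := by simp
  rw [this, h, comp_zero]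

lemma smul_invRotate [∀ n : ℤ, (shiftFunctor C n).Linear A] (T : Triangle C) (y : A)
    (h : y • T.mor₃ = 0) : y • T.invRotate.mor₁ = 0 := by
  have h2 : y • (shiftFunctor C (-1 : ℤ)).map T.mor₃ = 0 := by
    rw [← Functor.map_smul, h, Functor.map_zero]
  obtain ⟨v, hv⟩ : ∃ v : (T.obj₁⟦(1 : ℤ)⟧)⟦(-1 : ℤ)⟧ ⟶ T.obj₁,
    T.invRotate.mor₁ = -((shiftFunctor C (-1 : ℤ)).map T.mor₃ ≫ v) := ⟨_, rfl⟩
  have h5 : y • (-((shiftFunctor C (-1 : ℤ)).map T.mor₃ ≫ v)) = 0 := by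
    rw [smul_neg, neg_eq_zero, ← Linear.smul_comp, h2, zero_comp]
  exact (congrArg (y • ·) hv).trans h5

lemma Tower.nilp [∀ n : ℤ, (shiftFunctor C n).Linear A] {Y X : C} {xs : List A} {π : X ⟶ Y}
    (h : Tower A Y xs X π) : ∀ x ∈ xs, ∃ k : ℕ, x ^ k • 𝟙 X = 0 := by
  induction h with
  | nil => simp
  | @cons x xs X X' π g f ht hT ih =>
    intro y hy
    rw [List.mem_cons] at hy
    have hT' := inv_rot_of_distTriang _ hT
    rcases hy with rfl | hy
    · refine ⟨2, ?_⟩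
      rw [pow_two]
      refine smul_id_sq hT' y ?_ ?_
      · have h00 : (y • 𝟙 X) ≫ f = 0 := comp_distTriang_mor_zero₂₃ _ hT
        exact smul_invRotate _ y (by rwa [Linear.smul_comp, Category.id_comp] at h00)
      · have h0 : g ≫ (y • 𝟙 X) = 0 := comp_distTriang_mor_zero₁₂ _ hT
        rwa [Linear.comp_smul, Category.comp_id] at h0
    · obtain ⟨k, hk⟩ := ih y hy
      refine ⟨k + k, ?_⟩
      rw [pow_add]
      exact smul_id_sq hT' _ (smul_zero_of_id (smul_id_shift hk _) _) (smul_zero_of_id' hk _)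

/-- the annihilator ideal of an object. -/
def annI (X : C) : Ideal A where
  carrier := {s | s • 𝟙 X = 0}
  add_mem' := by intro a b ha hb; simp only [Set.mem_setOf_eq] at *; rw [add_smul, ha, hb, add_zero]
  zero_mem' := by simp
  smul_mem' := by intro c a ha; simp only [Set.mem_setOf_eq] at *; rw [smul_assoc, ha, smul_zero]

lemma Tower.ann [IsNoetherianRing A] [∀ n : ℤ, (shiftFunctor C n).Linear A] {Y X : C} {xs : List A}
    {π : X ⟶ Y}
    (h : Tower A Y xs X π) (a : Ideal A) (ha : a ≤ (Ideal.span {x | x ∈ xs}).radical) :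
    ∃ k : ℕ, ∀ r ∈ a ^ k, r • 𝟙 X = 0 := by
  have h1 : a ≤ (annI (A := A) X).radical := by
    refine ha.trans ?_
    rw [Ideal.radical_le_radical_iff, Ideal.span_le]
    intro x hx
    obtain ⟨k, hk⟩ := h.nilp x hx
    exact ⟨k, hk⟩
  obtain ⟨k, hk⟩ := Ideal.exists_pow_le_of_le_radical_of_fg h1 (IsNoetherian.noetherian a)
  exact ⟨k, fun r hr => hk hr⟩

end Towers

section LocFun
set_option linter.unusedSectionVars false
set_option linter.unusedVariables false

open CategoryTheory.Pretriangulated CategoryTheory.Limits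

variable {A : Type*} [CommRing A] {C : Type*} [Category C] [Preadditive C] [HasZeroObject C]
  [HasShift C ℤ] [∀ n : ℤ, (shiftFunctor C n).Additive] [Pretriangulated C] [Linear A C]
variable {A' : Type*} [CommRing A'] {C' : Type*} [Category C'] [Preadditive C'] [HasZeroObject C']
  [HasShift C' ℤ] [∀ n : ℤ, (shiftFunctor C' n).Additive] [Pretriangulated C'] [Linear A' C']

variable (L : C ⥤ C') [L.CommShift ℤ] [L.IsTriangulated] (ι : A →+* A') (S : Submonoid A)

/-- injectivity of the localization comparison. -/
def LInj (L : C ⥤ C') (S : Submonoid A) (Y X : C) : Prop :=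
  ∀ f : X ⟶ Y, L.map f = 0 → ∃ s ∈ S, s • f = 0

/-- surjectivity of the localization comparison. -/
def LSurj (L : C ⥤ C') (ι : A →+* A') (S : Submonoid A) (Y X : C) : Prop :=
  ∀ f' : L.obj X ⟶ L.obj Y, ∃ s ∈ S, ∃ f : X ⟶ Y, ι s • f' = L.map f

lemma LInj_iso (Y : C) {X X' : C} (e : X ≅ X') (h : LInj L S Y X) : LInj L S Y X' := by
  intro f hf
  obtain ⟨s, hs, hsf⟩ := h (e.hom ≫ f) (by rw [L.map_comp, hf, comp_zero])
  refine ⟨s, hs, ?_⟩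
  rw [← Linear.comp_smul] at hsf
  rwa [← cancel_epi e.hom, comp_zero]

lemma LSurj_iso (Y : C) {X X' : C} (e : X ≅ X') (h : LSurj L ι S Y X) : LSurj L ι S Y X' := by
  intro f'
  obtain ⟨s, hs, f, hf⟩ := h (L.map e.hom ≫ f')
  refine ⟨s, hs, e.inv ≫ f, ?_⟩
  rw [L.map_comp, ← hf, Linear.comp_smul, ← Category.assoc, ← L.map_comp]
  simp

lemma L_exact {T : Triangle C} (hT : T ∈ distTriang C) {Z : C'} (f : L.obj T.obj₂ ⟶ Z)
    (hf : L.map T.mor₁ ≫ f = 0) : ∃ g : L.obj T.obj₃ ⟶ Z, f = L.map T.mor₂ ≫ g :=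
  Triangle.yoneda_exact₂ _ (L.map_distinguished T hT) f hf

variable {L ι S}
variable (hL : ∀ {X X' : C} (r : A) (f : X ⟶ X'), L.map (r • f) = ι r • L.map f)

include hL

lemma LInj_step (Y : C) {T : Triangle C} (hT : T ∈ distTriang C)
    (h1 : LSurj L ι S Y (T.obj₁⟦(1 : ℤ)⟧)) (h2 : LInj L S Y T.obj₃) (h3 : LInj L S Y T.obj₁) :
    LInj L S Y T.obj₂ := by
  intro f hf
  obtain ⟨s, hs, hsf⟩ := h3 (T.mor₁ ≫ f) (by rw [L.map_comp, hf, comp_zero])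
  rw [← Linear.comp_smul] at hsf
  obtain ⟨g, hg⟩ := Triangle.yoneda_exact₂ T hT _ hsf
  have hLg : L.map T.mor₂ ≫ L.map g = 0 := by rw [← L.map_comp, ← hg, hL, hf, smul_zero]
  obtain ⟨h', hh2⟩ : ∃ h' : L.obj (T.obj₁⟦(1 : ℤ)⟧) ⟶ L.obj Y, L.map g = L.map T.mor₃ ≫ h' :=
    L_exact L (rot_of_distTriang _ hT) (L.map g) hLg
  obtain ⟨t, ht, h, hh⟩ := h1 h'
  have h0 : L.map (t • g - T.mor₃ ≫ h) = 0 := by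
    rw [Functor.map_sub, hL, L.map_comp, ← hh, hh2, Linear.comp_smul, sub_self]
  obtain ⟨v, hv, hvg⟩ := h2 _ h0
  refine ⟨v * t * s, S.mul_mem (S.mul_mem hv ht) hs, ?_⟩
  rw [mul_smul, hg, mul_smul, ← Linear.comp_smul, ← Linear.comp_smul]
  rw [smul_sub, sub_eq_zero] at hvg
  rw [hvg, Linear.comp_smul, comp_distTriang_mor_zero₂₃_assoc _ hT, zero_comp, smul_zero]

lemma LSurj_step (Y : C) {T : Triangle C} (hT : T ∈ distTriang C)
    (h1 : LSurj L ι S Y T.obj₃) (h2 : LSurj L ι S Y T.obj₁)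
    (h3 : LInj L S Y (T.obj₃⟦(-1 : ℤ)⟧)) :
    LSurj L ι S Y T.obj₂ := by
  intro f'
  obtain ⟨s, hs, f₁, hf₁⟩ := h2 (L.map T.mor₁ ≫ f')
  have hT' := inv_rot_of_distTriang _ hT
  obtain ⟨j, hz, hj⟩ : ∃ j : T.obj₃⟦(-1 : ℤ)⟧ ⟶ T.obj₁, j ≫ T.mor₁ = 0 ∧
      ∀ f : T.obj₁ ⟶ Y, j ≫ f = 0 → ∃ g, f = T.mor₁ ≫ g :=
    ⟨T.invRotate.mor₁, comp_distTriang_mor_zero₁₂ _ hT',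
      fun f hf => Triangle.yoneda_exact₂ _ hT' f hf⟩
  have h0 : L.map (j ≫ f₁) = 0 := by
    rw [L.map_comp, ← hf₁, Linear.comp_smul, ← Category.assoc, ← L.map_comp, hz, L.map_zero,
      zero_comp, smul_zero]
  obtain ⟨t, ht, htf⟩ := h3 _ h0
  rw [← Linear.comp_smul] at htf
  obtain ⟨f₂, hf₂⟩ := hj _ htf
  have h4 : L.map T.mor₁ ≫ (ι (t * s) • f' - L.map f₂) = 0 := by
    rw [Preadditive.comp_sub, ← L.map_comp, ← hf₂, hL, ← hf₁, map_mul, mul_smul, Linear.comp_smul,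
      Linear.comp_smul, sub_self]
  obtain ⟨k', hk'⟩ := L_exact L hT _ h4
  obtain ⟨v, hv, k, hk⟩ := h1 k'
  refine ⟨v * (t * s), S.mul_mem hv (S.mul_mem ht hs), T.mor₂ ≫ k + v • f₂, ?_⟩
  rw [L.map_add, L.map_comp, ← hk, Linear.comp_smul, ← hk', hL, smul_sub, map_mul, mul_smul]
  abel

/-- both comparisons -/
lemma LLoc_step (Y : C) (T : Triangle C) (hT : T ∈ distTriang C)
    (h1 : LInj L S Y (T.obj₁⟦(1 : ℤ)⟧) ∧ LSurj L ι S Y (T.obj₁⟦(1 : ℤ)⟧))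
    (h2 : LInj L S Y T.obj₃ ∧ LSurj L ι S Y T.obj₃)
    (h3 : LInj L S Y T.obj₁ ∧ LSurj L ι S Y T.obj₁)
    (h4 : LInj L S Y (T.obj₃⟦(-1 : ℤ)⟧) ∧ LSurj L ι S Y (T.obj₃⟦(-1 : ℤ)⟧)) :
    LInj L S Y T.obj₂ ∧ LSurj L ι S Y T.obj₂ :=
  ⟨LInj_step hL Y hT h1.2 h2.1 h3.1, LSurj_step hL Y hT h2.2 h3.2 h4.1⟩

lemma Tower.map {Y X : C} {xs : List A} {π : X ⟶ Y} (h : Tower A Y xs X π) :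
    Tower A' (L.obj Y) (xs.map ι) (L.obj X) (L.map π) := by
  induction h with
  | nil => rw [L.map_id]; exact Tower.nil
  | @cons x xs X X' π g f ht hT ih =>
    rw [L.map_comp]
    refine Tower.cons (L.map g) (L.map f ≫ (L.commShiftIso (1 : ℤ)).hom.app X') ih ?_
    have := L.map_distinguished _ hT
    have h2 : L.map (x • 𝟙 X) = ι x • 𝟙 (L.obj X) := by rw [hL, L.map_id]
    rw [← h2]
    exact this

end LocFun

section Derived
set_option linter.unusedSectionVars false
set_option linter.unusedVariables false

open CategoryTheory.Pretriangulated CategoryTheory.Limits DerivedCategory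

universe w w'

variable {R : Type u} [CommRing R] {R' : Type u} [CommRing R']
  [HasDerivedCategory.{w} (ModuleCat.{u} R)] [HasDerivedCategory.{w'} (ModuleCat.{u} R')]
  (F : ModuleCat.{u} R ⥤ ModuleCat.{u} R') [F.Additive] [PreservesFiniteLimits F]
  [PreservesFiniteColimits F] (ι : R →+* R')
  (hF : ∀ {X X' : ModuleCat.{u} R} (r : R) (f : X ⟶ X'), F.map (r • f) = ι r • F.map f)

include hF in
lemma semilinear {X X' : DerivedCategory (ModuleCat.{u} R)} (r : R) (f : X ⟶ X') :
    F.mapDerivedCategory.map (r • f) = ι r • F.mapDerivedCategory.map f := by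
  have key : ∀ K : CochainComplex (ModuleCat.{u} R) ℤ,
      F.mapDerivedCategory.map (r • 𝟙 (Q.obj K)) = ι r • 𝟙 _ := by
    intro K
    have h1 : r • 𝟙 (Q.obj K) = Q.map (r • 𝟙 K) := by rw [Functor.map_smul, Q.map_id]
    have h2 : (F.mapHomologicalComplex (ComplexShape.up ℤ)).map (r • 𝟙 K) =
        ι r • 𝟙 ((F.mapHomologicalComplex (ComplexShape.up ℤ)).obj K) := by
      ext1 i
      have : F.map (r • 𝟙 (K.X i)) = ι r • 𝟙 (F.obj (K.X i)) := by rw [hF, F.map_id]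
      exact this
    rw [h1, ← cancel_mono (F.mapDerivedCategoryFactors.hom.app K),
      F.mapDerivedCategoryFactors_hom_naturality, h2, Functor.map_smul, Q.map_id,
      Linear.comp_smul, Linear.smul_comp, Category.id_comp]
    exact congrArg (ι r • ·) (Category.comp_id _)
  have key2 : F.mapDerivedCategory.map (r • 𝟙 X) = ι r • 𝟙 _ := by
    let e := Q.objObjPreimageIso X
    have h1 : r • 𝟙 X = e.inv ≫ (r • 𝟙 _) ≫ e.hom := by
      rw [Linear.smul_comp, Linear.comp_smul, Category.id_comp, e.inv_hom_id]
    rw [h1, Functor.map_comp, Functor.map_comp, key, Linear.smul_comp, Linear.comp_smul,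
      Category.id_comp, ← Functor.map_comp, e.inv_hom_id, CategoryTheory.Functor.map_id]
  have h1 : r • f = (r • 𝟙 X) ≫ f := by rw [Linear.smul_comp, Category.id_comp]
  rw [h1, Functor.map_comp, key2, Linear.smul_comp, Category.id_comp]

end Derived

section Base
set_option linter.unusedSectionVars false
set_option linter.unusedVariables false

open CategoryTheory.Pretriangulated CategoryTheory.Limits DerivedCategory

section
variable {A : Type*} [CommRing A] {C : Type*} [Category C] [Preadditive C]
  [HasShift C ℤ] [∀ n : ℤ, (shiftFunctor C n).Additive] [Linear A C]
  [∀ n : ℤ, (shiftFunctor C n).Linear A]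

variable (A) in
/-- `Hom(X⟦-m⟧, Y) = Hom(X, Y⟦m⟧)`. -/
def shiftHomEquiv (X Y : C) (m : ℤ) : (X⟦-m⟧ ⟶ Y) ≃ₗ[A] (X ⟶ Y⟦m⟧) :=
  (LinearEquiv.ofBijective (Functor.mapLinearMap A (shiftFunctor C m) (X := X⟦-m⟧) (Y := Y))
    ⟨fun f g h => (shiftFunctor C m).map_injective h,
      fun f => ⟨(shiftFunctor C m).preimage f, (shiftFunctor C m).map_preimage f⟩⟩).trans
    (Linear.homCongr A ((shiftFunctorCompIsoId C (-m) m (by simp)).app X) (Iso.refl _))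
end

universe w w'

lemma single_hom_pos {R : Type u} [CommRing R] [HasDerivedCategory.{w} (ModuleCat.{u} R)]
    (N M : ModuleCat.{u} R) (n : ℤ) (hn : 0 < n)
    (f : ((singleFunctor _ 0).obj N)⟦n⟧ ⟶ (singleFunctor _ 0).obj M) : f = 0 := by
  have := TStructure.t.isLE_shift ((singleFunctor _ 0).obj N) 0 n (-n) (by simp)
  exact TStructure.t.zero f (-n) 0 (by omega)

lemma single_hom_proj {R : Type u} [CommRing R] [HasDerivedCategory.{w} (ModuleCat.{u} R)]
    (N M : ModuleCat.{u} R) [Projective N] (n : ℤ) (hn : n < 0)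
    (f : ((singleFunctor _ 0).obj N)⟦n⟧ ⟶ (singleFunctor _ 0).obj M) : f = 0 := by
  obtain ⟨m, rfl⟩ : ∃ m : ℕ, n = -((m + 1 : ℕ) : ℤ) := by
    obtain ⟨k, hk⟩ := Int.eq_ofNat_of_zero_le (show 0 ≤ -n - 1 by omega)
    exact ⟨k, by push_cast; omega⟩
  have h := Abelian.Ext.eq_zero_of_projective ((Abelian.Ext.homLinearEquiv (R := R)).symm
    (shiftHomEquiv R _ _ ((m + 1 : ℕ) : ℤ) f))
  exact (LinearEquiv.map_eq_zero_iff _).1 ((LinearEquiv.map_eq_zero_iff _).1 h)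

variable {R : Type u} [CommRing R] {R' : Type u} [CommRing R']
  [HasDerivedCategory.{w} (ModuleCat.{u} R)] [HasDerivedCategory.{w'} (ModuleCat.{u} R')]
  (F : ModuleCat.{u} R ⥤ ModuleCat.{u} R') [F.Additive] [PreservesFiniteLimits F]
  [PreservesFiniteColimits F] (ι : R →+* R') (S : Submonoid R)
  (hF : ∀ {X X' : ModuleCat.{u} R} (r : R) (f : X ⟶ X'), F.map (r • f) = ι r • F.map f)

/-- comparison of shifts of single objects. -/
def LsingleIso (N : ModuleCat.{u} R) (n : ℤ) :
    F.mapDerivedCategory.obj (((singleFunctor _ 0).obj N)⟦n⟧) ≅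
      ((singleFunctor _ 0).obj (F.obj N))⟦n⟧ :=
  (F.mapDerivedCategory.commShiftIso n).app _ ≪≫
    (shiftFunctor _ n).mapIso ((F.mapDerivedCategorySingleFunctor 0).app N)

lemma L_hom_zero (N M : ModuleCat.{u} R) (n : ℤ)
    (h : ∀ g : ((singleFunctor _ 0).obj (F.obj N))⟦n⟧ ⟶ (singleFunctor _ 0).obj (F.obj M), g = 0)
    (f : F.mapDerivedCategory.obj (((singleFunctor _ 0).obj N)⟦n⟧) ⟶
      F.mapDerivedCategory.obj ((singleFunctor _ 0).obj M)) : f = 0 := by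
  have := h ((LsingleIso F N n).inv ≫ f ≫ (F.mapDerivedCategorySingleFunctor 0).hom.app M)
  rw [← cancel_epi (LsingleIso F N n).inv,
    ← cancel_mono ((F.mapDerivedCategorySingleFunctor 0).hom.app M), Category.assoc, this]
  simp

/-- both comparisons hold. -/
def LLoc (Y X : DerivedCategory (ModuleCat.{u} R)) : Prop :=
  LInj F.mapDerivedCategory S Y X ∧ LSurj F.mapDerivedCategory ι S Y X

lemma LLoc_zero (N M : ModuleCat.{u} R) (n : ℤ)
    (h' : ∀ g : ((singleFunctor _ 0).obj N)⟦n⟧ ⟶ (singleFunctor _ 0).obj M, g = 0)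
    (h : ∀ g : ((singleFunctor _ 0).obj (F.obj N))⟦n⟧ ⟶ (singleFunctor _ 0).obj (F.obj M), g = 0) :
    LLoc F ι S ((singleFunctor _ 0).obj M) (((singleFunctor _ 0).obj N)⟦n⟧) := by
  refine ⟨fun f _ => ⟨1, S.one_mem, by rw [h' f, smul_zero]⟩, fun f => ⟨1, S.one_mem, 0, ?_⟩⟩
  rw [L_hom_zero F N M n h f, Functor.map_zero, smul_zero]

lemma LLoc_iso (Y : DerivedCategory (ModuleCat.{u} R)) {X X' : DerivedCategory (ModuleCat.{u} R)}
    (e : X ≅ X') (h : LLoc F ι S Y X) : LLoc F ι S Y X' :=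
  ⟨LInj_iso _ _ _ e h.1, LSurj_iso _ _ _ _ e h.2⟩

lemma LLoc_proj (N M : ModuleCat.{u} R) [Projective N] [Projective (F.obj N)]
    (hi : ∀ f : N ⟶ M, F.map f = 0 → ∃ s ∈ S, s • f = 0)
    (hs : ∀ f' : F.obj N ⟶ F.obj M, ∃ s ∈ S, ∃ f : N ⟶ M, ι s • f' = F.map f) (n : ℤ) :
    LLoc F ι S ((singleFunctor _ 0).obj M) (((singleFunctor _ 0).obj N)⟦n⟧) := by
  rcases lt_trichotomy n 0 with hn | rfl | hn
  · exact LLoc_zero F ι S N M n (single_hom_proj N M n hn) (single_hom_proj _ _ n hn)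
  · refine LLoc_iso F ι S _ ((shiftFunctorZero _ ℤ).symm.app _) ⟨?_, ?_⟩
    · intro f hf
      obtain ⟨f, rfl⟩ := (singleFunctor (ModuleCat.{u} R) 0).map_surjective f
      have h1 := (F.mapDerivedCategorySingleFunctor 0).hom.naturality f
      have h2 : (singleFunctor (ModuleCat.{u} R') 0).map (F.map f) = 0 := by
        rw [← cancel_epi ((F.mapDerivedCategorySingleFunctor 0).hom.app N), comp_zero]
        refine h1.symm.trans ?_
        refine (congrArg (· ≫ _) hf).trans zero_comp
      obtain ⟨s, hs, hsf⟩ := hi f ((singleFunctor (ModuleCat.{u} R') 0).map_injective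
        (h2.trans (Functor.map_zero _ _ _).symm))
      exact ⟨s, hs, by rw [← Functor.map_smul, hsf, Functor.map_zero]⟩
    · intro f'
      obtain ⟨g, hg⟩ := (singleFunctor (ModuleCat.{u} R') 0).map_surjective
        ((F.mapDerivedCategorySingleFunctor 0).inv.app N ≫ f' ≫
          (F.mapDerivedCategorySingleFunctor 0).hom.app M)
      obtain ⟨s, hs, f, hf⟩ := hs g
      refine ⟨s, hs, (singleFunctor (ModuleCat.{u} R) 0).map f, ?_⟩
      have h1 := (F.mapDerivedCategorySingleFunctor 0).hom.naturality f
      rw [← cancel_mono ((F.mapDerivedCategorySingleFunctor 0).hom.app M)]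
      refine Eq.trans ?_ h1.symm
      rw [Functor.comp_map, ← hf, Functor.map_smul, hg]
      simp
  · exact LLoc_zero F ι S N M n (single_hom_pos N M n hn) (single_hom_pos _ _ n hn)

include hF in
lemma LLoc_finite [IsNoetherianRing R] [F.PreservesProjectiveObjects] (M : ModuleCat.{u} R)
    (h0 : ∀ N : ModuleCat.{u} R, Module.Finite R N →
      (∀ f : N ⟶ M, F.map f = 0 → ∃ s ∈ S, s • f = 0) ∧
      (∀ f' : F.obj N ⟶ F.obj M, ∃ s ∈ S, ∃ f : N ⟶ M, ι s • f' = F.map f))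
    (N : ModuleCat.{u} R) (hN : Module.Finite R N) (n : ℤ) :
    LLoc F ι S ((singleFunctor _ 0).obj M) (((singleFunctor _ 0).obj N)⟦n⟧) := by
  have key : ∀ m : ℕ, ∀ N : ModuleCat.{u} R, Module.Finite R N →
      LLoc F ι S ((singleFunctor _ 0).obj M) (((singleFunctor _ 0).obj N)⟦(1 - m : ℤ)⟧) := by
    intro m
    induction m with
    | zero =>
      intro N _
      exact LLoc_zero F ι S N M _ (single_hom_pos N M _ (by simp)) (single_hom_pos _ _ _ (by simp))
    | succ m ih =>
      set n : ℤ := 1 - ((m + 1 : ℕ) : ℤ) with hn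
      have hn1 : (1 : ℤ) - m = n + 1 := by push_cast at hn; omega
      rw [hn1] at ih
      have cover : ∀ N : ModuleCat.{u} R, Module.Finite R N →
          ∃ T ∈ distTriang (DerivedCategory (ModuleCat.{u} R)), ∃ P K : ModuleCat.{u} R,
            Module.Finite R K ∧ T.obj₃ = (singleFunctor _ 0).obj N ∧
            T.obj₁ = (singleFunctor _ 0).obj K ∧
            T.obj₂ = (singleFunctor _ 0).obj P ∧ ∀ k : ℤ,
              LLoc F ι S ((singleFunctor _ 0).obj M) (((singleFunctor _ 0).obj P)⟦k⟧) := by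
        intro N hN
        obtain ⟨k, f, hf⟩ := Module.Finite.exists_fin' R N
        have hse := LinearMap.shortExact_shortComplexKer hf
        have : Projective (ModuleCat.of R (Fin k → R)) :=
          (IsProjective.iff_projective (R := R) (Fin k → R)).1 inferInstance
        have : Projective (F.obj (ModuleCat.of R (Fin k → R))) := F.projective_obj _
        have h0' := h0 (ModuleCat.of R (Fin k → R)) (inferInstanceAs (Module.Finite R (Fin k → R)))
        refine ⟨hse.singleTriangle, hse.singleTriangle_distinguished,
          ModuleCat.of R (Fin k → R), ModuleCat.of R (LinearMap.ker f), ?_, rfl, rfl, rfl,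
          LLoc_proj F ι S _ _ h0'.1 h0'.2⟩
        exact inferInstanceAs (Module.Finite R (LinearMap.ker f))
      have inj : ∀ N : ModuleCat.{u} R, Module.Finite R N →
          LInj F.mapDerivedCategory S ((singleFunctor _ 0).obj M)
            (((singleFunctor _ 0).obj N)⟦n⟧) := by
        intro N hN
        obtain ⟨T, hT, P, K, hK, e3, e1, e2, hP⟩ := cover N hN
        have hT' := Triangle.shift_distinguished _ (rot_of_distTriang _ hT) n
        rw [← e3]
        rw [← e2] at hP
        refine LInj_step (semilinear F ι hF) _ hT' ?_ ?_ ?_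
        · exact LSurj_iso _ _ _ _ ((shiftFunctorAdd' _ n 1 (n + 1) rfl).app _) (hP (n + 1)).2
        · refine LInj_iso _ _ _ ((shiftFunctorAdd' _ 1 n (n + 1) (by omega)).app _) ?_
          rw [e1]
          exact (ih K hK).1
        · exact (hP n).1
      intro N hN
      refine ⟨inj N hN, ?_⟩
      obtain ⟨T, hT, P, K, hK, e3, e1, e2, hP⟩ := cover N hN
      have hT' := Triangle.shift_distinguished _ (rot_of_distTriang _ hT) n
      rw [← e3]
      rw [← e2] at hP
      refine LSurj_step (semilinear F ι hF) _ hT' ?_ ?_ ?_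
      · refine LSurj_iso _ _ _ _ ((shiftFunctorAdd' _ 1 n (n + 1) (by omega)).app _) ?_
        rw [e1]
        exact (ih K hK).2
      · exact (hP n).2
      · refine LInj_iso _ _ _ ((shiftFunctorAdd' _ (n + 1) (-1) n (by omega)).app _ ≪≫
          (shiftFunctor _ (-1 : ℤ)).mapIso ((shiftFunctorAdd' _ 1 n (n + 1) (by omega)).app T.obj₁))
          (X := T.obj₁⟦n⟧) ?_
        rw [e1]
        exact inj K hK
  rcases le_or_gt n 1 with hn | hn
  · obtain ⟨m, hm⟩ := Int.eq_ofNat_of_zero_le (sub_nonneg.2 hn)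
    have : n = 1 - (m : ℤ) := by omega
    rw [this]; exact key m N hN
  · exact LLoc_zero F ι S N M n (single_hom_pos N M n (by omega)) (single_hom_pos _ _ n (by omega))

end Base

section Devissage
set_option linter.unusedSectionVars false
set_option linter.unusedVariables false

open CategoryTheory.Pretriangulated CategoryTheory.Limits DerivedCategory

universe w

variable {R : Type u} [CommRing R] [HasDerivedCategory.{w} (ModuleCat.{u} R)]

/-- homs between single objects -/
def singleHomEquiv (N M : ModuleCat.{u} R) :
    (N ⟶ M) ≃ₗ[R] ((singleFunctor _ 0).obj N ⟶ (singleFunctor (ModuleCat.{u} R) 0).obj M) :=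
  LinearEquiv.ofBijective (Functor.mapLinearMap R (singleFunctor (ModuleCat.{u} R) 0))
    ⟨fun f g h => (singleFunctor (ModuleCat.{u} R) 0).map_injective h,
      fun f => (singleFunctor (ModuleCat.{u} R) 0).map_surjective f⟩

lemma finite_hom_single [IsNoetherianRing R] (N M : ModuleCat.{u} R) (hN : Module.Finite R N)
    (hM : Module.Finite R M) (n : ℤ) :
    Module.Finite R ((singleFunctor _ 0).obj N ⟶ ((singleFunctor _ 0).obj M)⟦n⟧) := by
  rcases lt_or_ge n 0 with hn | hn
  · have : Subsingleton ((singleFunctor _ 0).obj N ⟶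
        ((singleFunctor (ModuleCat.{u} R) 0).obj M)⟦n⟧) := by
      refine ⟨fun f g => ?_⟩
      have := TStructure.t.isGE_shift ((singleFunctor _ 0).obj M) 0 n (-n) (by simp)
      rw [TStructure.t.zero f 0 (-n) (by omega), TStructure.t.zero g 0 (-n) (by omega)]
    infer_instance
  · obtain ⟨m, rfl⟩ := Int.eq_ofNat_of_zero_le hn
    have := ModuleCat.finite_ext R N M m
    exact Module.Finite.equiv (Abelian.Ext.homLinearEquiv (R := R) (X := N) (Y := M) (n := m))

lemma single_case [IsNoetherianRing R] (a : Ideal R) (X : DerivedCategory (ModuleCat.{u} R)) (s : ℤ)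
    [X.IsGE s] [X.IsLE s] (k : ℕ) (hk : ∀ r ∈ a ^ k, r • 𝟙 X = 0)
    (hf : Module.Finite R ((singleFunctor _ 0).obj (ModuleCat.of R (R ⧸ a)) ⟶ X⟦s⟧)) :
    ∃ N : ModuleCat.{u} R, Module.Finite R N ∧ Nonempty (((singleFunctor _ 0).obj N)⟦-s⟧ ≅ X) := by
  have h1 : (X⟦s⟧).IsGE 0 := TStructure.t.isGE_shift X s s 0 (by simp)
  have h2 : (X⟦s⟧).IsLE 0 := TStructure.t.isLE_shift X s s 0 (by simp)
  obtain ⟨N, ⟨e⟩⟩ := exists_iso_singleFunctor_obj_of_isGE_of_isLE (X⟦s⟧) 0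
  refine ⟨N, ?_, ⟨(shiftFunctor _ (-s)).mapIso e.symm ≪≫
    (shiftFunctorCompIsoId _ s (-s) (by simp)).app X⟩⟩
  have hN : ∀ r ∈ a ^ k, ∀ n : N, r • n = 0 := by
    intro r hr n
    have h3 : r • 𝟙 ((singleFunctor (ModuleCat.{u} R) 0).obj N) = 0 := by
      have h4 := smul_id_shift (hk r hr) s
      have : r • 𝟙 ((singleFunctor (ModuleCat.{u} R) 0).obj N) =
          e.inv ≫ (r • 𝟙 (X⟦s⟧)) ≫ e.hom := by simp
      rw [this, h4]; simp
    have h5 : r • 𝟙 N = 0 := by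
      apply (singleHomEquiv N N).injective
      rw [map_zero, map_smul]
      refine Eq.trans ?_ h3
      exact congrArg (r • ·) ((singleFunctor (ModuleCat.{u} R) 0).map_id N)
    have h6 := congrArg (fun f : N ⟶ N => f.hom n) h5
    exact h6
  have hf' : Module.Finite R ((R ⧸ a) →ₗ[R] N) := by
    have h7 := fin_iso (A := R) _ e hf
    exact Module.Finite.equiv ((singleHomEquiv (ModuleCat.of R (R ⧸ a)) N).symm.trans
      (ModuleCat.homLinearEquiv (S := R)))
  let ev : ((R ⧸ a) →ₗ[R] N) →ₗ[R] N := LinearMap.applyₗ (1 : R ⧸ a)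
  refine finite_of_socle a (LinearMap.range ev) ?_ inferInstance k hN
  intro n hn
  have hker : a ≤ LinearMap.ker (LinearMap.toSpanSingleton R N n) := by
    intro r hr
    rw [LinearMap.mem_ker, LinearMap.toSpanSingleton_apply]; exact hn r hr
  refine ⟨Submodule.liftQ a (LinearMap.toSpanSingleton R N n) hker, ?_⟩
  exact (Submodule.liftQ_apply a (LinearMap.toSpanSingleton R N n) (h := hker) (1 : R)).trans
      ((LinearMap.toSpanSingleton_apply R N n 1).trans (one_smul R n))

lemma devissage [IsNoetherianRing R] (a : Ideal R) (P : DerivedCategory (ModuleCat.{u} R) → Prop)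
    (iso : ∀ {X X' : DerivedCategory (ModuleCat.{u} R)}, (X ≅ X') → P X → P X')
    (hext : ∀ T ∈ distTriang (DerivedCategory (ModuleCat.{u} R)), (∀ n : ℤ, P (T.obj₁⟦n⟧)) →
      (∀ n : ℤ, P (T.obj₃⟦n⟧)) → ∀ n : ℤ, P (T.obj₂⟦n⟧))
    (base : ∀ N : ModuleCat.{u} R, Module.Finite R N → ∀ n : ℤ, P (((singleFunctor _ 0).obj N)⟦n⟧))
    (l : ℕ) : ∀ (X : DerivedCategory (ModuleCat.{u} R)) (s : ℤ) (_ : X.IsGE s)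
      (_ : X.IsLE (s + l)) (k : ℕ) (_ : ∀ r ∈ a ^ k, r • 𝟙 X = 0)
      (_ : ∀ n : ℤ, Module.Finite R
        ((singleFunctor _ 0).obj (ModuleCat.of R (R ⧸ a)) ⟶ X⟦n⟧)), ∀ n : ℤ, P (X⟦n⟧) := by
  have base' : ∀ N : ModuleCat.{u} R, Module.Finite R N → ∀ (X) (s : ℤ)
      (e : ((singleFunctor _ 0).obj N)⟦-s⟧ ≅ X) (n : ℤ), P (X⟦n⟧) := by
    intro N hN X s e n
    exact iso ((shiftFunctorAdd' _ (-s) n (-s + n) rfl).app _ ≪≫ (shiftFunctor _ n).mapIso e)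
      (base N hN _)
  induction l with
  | zero =>
    intro X s _ h k hk hf n
    have h2 : X.IsLE s := by simpa using h
    obtain ⟨N, hN, ⟨e⟩⟩ := single_case a X s k hk (hf s)
    exact base' N hN X s e n
  | succ l ih =>
    intro X s hge hle k hk hf n
    obtain ⟨A, B, hA, hB, f, g, h, hT⟩ := TStructure.t.exists_triangle X s (s + 1) rfl
    have hA : A.IsLE s := ⟨hA⟩
    have hB : B.IsGE (s + 1) := ⟨hB⟩
    have hB1 : (B⟦(-1 : ℤ)⟧).IsGE (s + 2) := TStructure.t.isGE_shift B (s + 1) (-1) (s + 2) (by omega)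
    have hA1 : (A⟦(1 : ℤ)⟧).IsLE (s - 1) := TStructure.t.isLE_shift A s 1 (s - 1) (by omega)
    have hTi := inv_rot_of_distTriang _ hT
    have hTr := rot_of_distTriang _ hT
    have hAge : A.IsGE s := TStructure.t.isGE₂ _ hTi s
      (TStructure.t.isGE_of_ge (B⟦(-1 : ℤ)⟧) s (s + 2) (by omega)) hge
    have hBle : B.IsLE (s + 1 + l) := TStructure.t.isLE₂ _ hTr (s + 1 + l)
      (by have : s + ((l + 1 : ℕ) : ℤ) = s + 1 + l := by push_cast; ring
          rw [← this]; exact hle)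
      (TStructure.t.isLE_of_le (A⟦(1 : ℤ)⟧) (s - 1) _ (by omega))
    have hkA : ∀ r ∈ a ^ k, r • 𝟙 A = 0 := by
      intro r hr
      have h0 : (r • 𝟙 A) ≫ f = 0 := by
        rw [Linear.smul_comp, Category.id_comp]
        exact smul_zero_of_id' (hk r hr) f
      obtain ⟨v, hv⟩ := Triangle.coyoneda_exact₂ _ hTi (r • 𝟙 A) h0
      have hv0 : v = 0 := TStructure.t.zero (X := A) (Y := B⟦(-1 : ℤ)⟧) v s (s + 2) (by omega)
      rw [hv0] at hv
      exact hv.trans zero_comp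
    have hkB : ∀ r ∈ a ^ k, r • 𝟙 B = 0 := by
      intro r hr
      have h0 : g ≫ (r • 𝟙 B) = 0 := by
        rw [Linear.comp_smul, Category.comp_id]
        exact smul_zero_of_id (hk r hr) g
      obtain ⟨v, hv⟩ := Triangle.yoneda_exact₂ _ hTr (r • 𝟙 B) h0
      have hv0 : v = 0 := TStructure.t.zero (X := A⟦(1 : ℤ)⟧) (Y := B) v (s - 1) (s + 1) (by omega)
      rw [hv0] at hv
      exact hv.trans comp_zero
    have hfA : Module.Finite R
        ((singleFunctor _ 0).obj (ModuleCat.of R (R ⧸ a)) ⟶ A⟦s⟧) := by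
      have hTs := Triangle.shift_distinguished _ hTi s
      have hBs : ((B⟦(-1 : ℤ)⟧)⟦s⟧).IsGE 2 :=
        TStructure.t.isGE_shift (B⟦(-1 : ℤ)⟧) (s + 2) s 2 (by omega)
      have : Subsingleton ((singleFunctor _ 0).obj (ModuleCat.of R (R ⧸ a)) ⟶
          (B⟦(-1 : ℤ)⟧)⟦s⟧) := by
        refine ⟨fun f g => ?_⟩
        rw [TStructure.t.zero f 0 2 (by omega), TStructure.t.zero g 0 2 (by omega)]
      have hfin : Module.Finite R ((singleFunctor _ 0).obj (ModuleCat.of R (R ⧸ a)) ⟶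
          (B⟦(-1 : ℤ)⟧)⟦s⟧) := inferInstance
      exact fin_step (A := R) _ _ hTs (hf s) hfin
    obtain ⟨N, hN, ⟨e⟩⟩ := single_case a A s k hkA hfA
    have hfA' : ∀ n : ℤ, Module.Finite R
        ((singleFunctor _ 0).obj (ModuleCat.of R (R ⧸ a)) ⟶ A⟦n⟧) := by
      intro n
      exact fin_iso (A := R) _ ((shiftFunctorAdd' _ (-s) n (-s + n) rfl).app _ ≪≫
        (shiftFunctor _ n).mapIso e) (finite_hom_single _ N
          (inferInstanceAs (Module.Finite R (R ⧸ a))) hN _)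
    have hfB : ∀ n : ℤ, Module.Finite R
        ((singleFunctor _ 0).obj (ModuleCat.of R (R ⧸ a)) ⟶ B⟦n⟧) := by
      refine closure_shift (fun Z => Module.Finite R
        ((singleFunctor _ 0).obj (ModuleCat.of R (R ⧸ a)) ⟶ Z)) (fin_iso _)
        (fun T hT _ h3 h1 _ => fin_step _ T hT h3 h1) _ hTr hf ?_
      intro n
      exact fin_iso (A := R) _ ((shiftFunctorAdd' _ 1 n (1 + n) rfl).app A) (hfA' (1 + n))
    exact hext _ hT (base' N hN A s e) (ih B (s + 1) hB hBle k hkB hfB) n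

end Devissage

section TowerLoc
set_option linter.unusedSectionVars false
set_option linter.unusedVariables false

open CategoryTheory.Pretriangulated CategoryTheory.Limits DerivedCategory

universe w w'

variable {R : Type u} [CommRing R] [HasDerivedCategory.{w} (ModuleCat.{u} R)]

lemma tower_bounds {M : ModuleCat.{u} R} {Y X : DerivedCategory (ModuleCat.{u} R)} {xs : List R}
    {π : X ⟶ Y} (h : Tower R Y xs X π) (hY0 : Y.IsGE 0) (hY1 : Y.IsLE 0) :
    X.IsGE 0 ∧ X.IsLE (0 + (xs.length : ℕ)) := by
  induction h with
  | nil => exact ⟨hY0, by simpa using hY1⟩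
  | @cons x xs X X' π g f ht hT ih =>
    obtain ⟨h0, h1⟩ := ih
    have hTi := inv_rot_of_distTriang _ hT
    have hs0 : (X⟦(-1 : ℤ)⟧).IsGE 1 := TStructure.t.isGE_shift X 0 (-1) 1 (by omega)
    have hs1 : (X⟦(-1 : ℤ)⟧).IsLE (0 + ((x :: xs).length : ℕ)) :=
      TStructure.t.isLE_shift X (0 + (xs.length : ℕ)) (-1) _ (by simp)
    exact ⟨TStructure.t.isGE₂ _ hTi 0
      (TStructure.t.isGE_of_ge (X⟦(-1 : ℤ)⟧) 0 1 (by omega)) h0,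
      TStructure.t.isLE₂ _ hTi _ hs1
        (TStructure.t.isLE_of_le X (0 + (xs.length : ℕ)) _ (by simp))⟩

lemma finite_single_hom (N M : ModuleCat.{u} R)
    (h : ∀ i : ℕ, Module.Finite R (Abelian.Ext.{u} N M i)) (n : ℤ) :
    Module.Finite R ((singleFunctor _ 0).obj N ⟶ ((singleFunctor _ 0).obj M)⟦n⟧) := by
  rcases lt_or_ge n 0 with hn | hn
  · have : Subsingleton ((singleFunctor _ 0).obj N ⟶
        ((singleFunctor (ModuleCat.{u} R) 0).obj M)⟦n⟧) := by
      refine ⟨fun f g => ?_⟩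
      have := TStructure.t.isGE_shift ((singleFunctor _ 0).obj M) 0 n (-n) (by simp)
      rw [TStructure.t.zero f 0 (-n) (by omega), TStructure.t.zero g 0 (-n) (by omega)]
    infer_instance
  · obtain ⟨m, rfl⟩ := Int.eq_ofNat_of_zero_le hn
    have := h m
    exact Module.Finite.equiv (Abelian.Ext.homLinearEquiv (R := R) (X := N) (Y := M) (n := m))

variable {R' : Type u} [CommRing R'] [HasDerivedCategory.{w'} (ModuleCat.{u} R')]
  (F : ModuleCat.{u} R ⥤ ModuleCat.{u} R') [F.Additive] [PreservesFiniteLimits F]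
  [PreservesFiniteColimits F] (ι : R →+* R') (S : Submonoid R)
  (hF : ∀ {X X' : ModuleCat.{u} R} (r : R) (f : X ⟶ X'), F.map (r • f) = ι r • F.map f)

include hF in
lemma LLoc_tower [IsNoetherianRing R] [F.PreservesProjectiveObjects] (M : ModuleCat.{u} R)
    (h0 : ∀ N : ModuleCat.{u} R, Module.Finite R N →
      (∀ f : N ⟶ M, F.map f = 0 → ∃ s ∈ S, s • f = 0) ∧
      (∀ f' : F.obj N ⟶ F.obj M, ∃ s ∈ S, ∃ f : N ⟶ M, ι s • f' = F.map f))
    (a : Ideal R) (hfin : ∀ i : ℕ, Module.Finite R (Abelian.Ext.{u} (ModuleCat.of R (R ⧸ a)) M i))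
    {xs : List R} {X : DerivedCategory (ModuleCat.{u} R)} {π : X ⟶ (singleFunctor _ 0).obj M}
    (h : Tower R ((singleFunctor _ 0).obj M) xs X π)
    (hxs : a ≤ (Ideal.span {x | x ∈ xs}).radical) (n : ℤ) :
    LLoc F ι S ((singleFunctor _ 0).obj M) (X⟦n⟧) := by
  obtain ⟨hge, hle⟩ := tower_bounds (M := M) h inferInstance inferInstance
  obtain ⟨k, hk⟩ := h.ann a hxs
  refine devissage a (LLoc F ι S ((singleFunctor _ 0).obj M)) (LLoc_iso F ι S _) ?_
    (fun N hN n => LLoc_finite F ι S hF M h0 N hN n) xs.length X 0 hge hle k hk ?_ n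
  · intro T hT h1 h3
    exact closure_shift (LLoc F ι S ((singleFunctor _ 0).obj M)) (LLoc_iso F ι S _)
      (fun T hT => LLoc_step (semilinear F ι hF) _ T hT) T hT h1 h3
  · exact h.closed (fun Z => Module.Finite R
      ((singleFunctor _ 0).obj (ModuleCat.of R (R ⧸ a)) ⟶ Z)) (fin_iso _)
        (fun T hT _ h3 h1 _ => fin_step _ T hT h3 h1) (finite_single_hom _ M hfin)

end TowerLoc

section DCHom
set_option linter.unusedSectionVars false
set_option linter.unusedVariables false

open CategoryTheory.Pretriangulated CategoryTheory.Limits DerivedCategory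

universe w w'

variable {R : Type u} [CommRing R] [HasDerivedCategory.{w} (ModuleCat.{u} R)]

lemma single_hom_inj (N M : ModuleCat.{u} R) [Injective M] (n : ℤ) (hn : 0 < n)
    (f : ((singleFunctor _ 0).obj N) ⟶ ((singleFunctor _ 0).obj M)⟦n⟧) : f = 0 := by
  obtain ⟨m, rfl⟩ : ∃ m : ℕ, n = ((m + 1 : ℕ) : ℤ) := by
    obtain ⟨k, hk⟩ := Int.eq_ofNat_of_zero_le (show 0 ≤ n - 1 by omega)
    exact ⟨k, by push_cast; omega⟩
  have h := Abelian.Ext.eq_zero_of_injective ((Abelian.Ext.homLinearEquiv (R := R)).symm f)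
  exact (LinearEquiv.map_eq_zero_iff _).1 h

lemma DC_iso' (x : R) (Z : DerivedCategory (ModuleCat.{u} R)) {X X' : DerivedCategory (ModuleCat.{u} R)}
    (e : X ≅ X') (h : DC x (Z ⟶ X)) : DC x (Z ⟶ X') :=
  h.of_equiv (Linear.homCongr R (Iso.refl Z) e)

lemma DC_ext (x : R) (M : ModuleCat.{u} R) (hx : ∀ y : M, ∃ n : ℕ, x ^ n • y = 0) (m : ℕ) :
    ∀ N : ModuleCat.{u} R,
      DC x ((singleFunctor _ 0).obj M ⟶ ((singleFunctor _ 0).obj N)⟦(m : ℤ)⟧) := by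
  induction m with
  | zero =>
    intro N
    refine DC_iso' x _ ((shiftFunctorZero _ ℤ).symm.app _) ?_
    exact (DC.hom (N := N) hx).of_equiv ((ModuleCat.homLinearEquiv (S := R)).symm.trans
      (singleHomEquiv M N))
  | succ m ih =>
    intro N
    let Sh : ShortComplex (ModuleCat.{u} R) :=
      ShortComplex.mk (Injective.ι N) (cokernel.π (Injective.ι N)) (cokernel.condition _)
    have hSh : Sh.ShortExact :=
      { exact := ShortComplex.exact_cokernel _
        mono_f := inferInstanceAs (Mono (Injective.ι N))
        epi_g := inferInstanceAs (Epi (cokernel.π (Injective.ι N))) }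
    have hT := hSh.singleTriangle_distinguished
    have hT1 := rot_of_distTriang _ hT
    have hT2 := rot_of_distTriang _ hT1
    have hs1 := Triangle.shift_distinguished _ hT1 (m : ℤ)
    have hs2 := Triangle.shift_distinguished _ hT2 (m : ℤ)
    let W := (singleFunctor _ 0).obj M
    have e1 := exact_coyo (A := R) _ hs1 W
    have e2 := exact_coyo (A := R) _ hs2 W
    have hsub : Subsingleton (W ⟶ (((singleFunctor _ 0).obj (Injective.under N))⟦(1 : ℤ)⟧)⟦(m : ℤ)⟧) := by
      have : ∀ f : W ⟶ (((singleFunctor _ 0).obj (Injective.under N))⟦(1 : ℤ)⟧)⟦(m : ℤ)⟧,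
          f = 0 := by
        intro f
        have h1 := single_hom_inj M (Injective.under N) (1 + m) (by omega)
          (f ≫ (shiftFunctorAdd' _ 1 (m : ℤ) (1 + m) rfl).inv.app _)
        exact zero_of_comp_mono _ h1
      exact ⟨fun f g => by rw [this f, this g]⟩
    have hsub' : Subsingleton (W ⟶ (hSh.singleTriangle.rotate.rotate⟦(m : ℤ)⟧).obj₃) := hsub
    refine DC_iso' x W ((shiftFunctorAdd' _ 1 (m : ℤ) ((m + 1 : ℕ) : ℤ) (by push_cast; ring)).symm.app
      ((singleFunctor _ 0).obj N)) ?_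
    exact DC.five x _ _ _ (0 : _ →ₗ[R] PUnit.{1}) e1 e2
      (fun y => ⟨fun _ => ⟨0, hsub'.elim _ _⟩, fun _ => rfl⟩) (ih _) (ih _)
      (DC.of_subsingleton x) (DC.of_subsingleton x)

lemma DC_single (x : R) (M N : ModuleCat.{u} R) (hx : ∀ y : M, ∃ n : ℕ, x ^ n • y = 0) (n : ℤ) :
    DC x (((singleFunctor _ 0).obj M)⟦n⟧ ⟶ (singleFunctor _ 0).obj N) := by
  rcases lt_or_ge 0 n with hn | hn
  · have : Subsingleton (((singleFunctor _ 0).obj M)⟦n⟧ ⟶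
        (singleFunctor (ModuleCat.{u} R) 0).obj N) :=
      ⟨fun f g => by rw [single_hom_pos M N n hn f, single_hom_pos M N n hn g]⟩
    exact DC.of_subsingleton x
  · obtain ⟨m, hm⟩ := Int.eq_ofNat_of_zero_le (show 0 ≤ -n by omega)
    obtain rfl : n = -(m : ℤ) := by omega
    exact (DC_ext x M hx m N).of_equiv (shiftHomEquiv R _ _ (m : ℤ)).symm

end DCHom

section OldExt
set_option linter.unusedSectionVars false
set_option linter.unusedVariables false

open CategoryTheory.Limits

variable {R : Type u} [CommRing R] {X Y : ModuleCat.{u} R} (P : ProjectiveResolution X)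

lemma extMk_eq_zero_iff' (i j k : ℕ) (hk : j + 1 = k) (hi : (ComplexShape.up ℕ).prev j = i)
    (f : P.complex.X j ⟶ Y) (hf : P.complex.d k j ≫ f = 0) :
    P.extMk f k hk hf = 0 ↔ ∃ g : P.complex.X i ⟶ Y, P.complex.d j i ≫ g = f := by
  rcases j with _ | j
  · rw [CochainComplex.prev_nat_zero] at hi
    subst hi
    have h0 : P.complex.d 0 0 = 0 := P.complex.shape 0 0 (by simp)
    constructor
    · intro h
      refine ⟨0, ?_⟩
      rw [comp_zero]
      rw [← P.extEquivCohomologyClass.apply_eq_iff_eq, 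
        ProjectiveResolution.extEquivCohomologyClass_extMk,
        ProjectiveResolution.extEquivCohomologyClass_zero,
        CochainComplex.HomComplex.CohomologyClass.mk_eq_zero_iff,
        CochainComplex.HomComplex.Cocycle.toSingleMk_mem_coboundaries_iff _ _ _ _ _ 1 (by simp)] at h
      obtain ⟨g, hg⟩ := h
      have hz : IsZero (P.cochainComplex.X 1) :=
        P.cochainComplex.isZero_of_isStrictlyLE 0 1 (by omega)
      rw [hz.eq_of_src g 0, comp_zero] at hg
      exact (zero_of_epi_comp _ hg.symm).symm
    · rintro ⟨g, hg⟩
      rw [h0, zero_comp] at hg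
      subst hg
      exact P.extMk_zero _ _
  · rw [CochainComplex.prev_nat_succ] at hi
    subst hi
    exact P.extMk_eq_zero_iff f k hk hf j rfl

/-- cocycles to Ext -/
def cocyToExt (j k : ℕ) (hk : j + 1 = k) :
    LinearMap.ker (Linear.leftComp R Y (P.complex.d k j)) →ₗ[R] Abelian.Ext.{u} X Y j where
  toFun f := P.extMk f.1 k hk f.2
  map_add' f g := (P.add_extMk f.1 g.1 k hk f.2 g.2).symm
  map_smul' r f := by
    rw [RingHom.id_apply, Abelian.Ext.smul_eq_comp_mk₀]
    refine Eq.trans ?_ (P.extMk_comp_mk₀ f.1 k hk f.2 (r • 𝟙 Y)).symm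
    congr 1

/-- comparison of both Abelian.Ext. -/
def extCmp (j : ℕ) : ((_root_.Ext R (ModuleCat.{u} R) j).obj (Opposite.op X)).obj Y ≃ₗ[R]
    Abelian.Ext.{u} X Y j := by
  let K := P.complex.linearYonedaObj R Y
  let Q := (LinearMap.ker (Linear.leftComp R Y (P.complex.d (j + 1) j)) ⧸
    (LinearMap.range (K.sc' ((ComplexShape.up ℕ).prev j) j (j + 1)).moduleCatToCycles))
  let e1 : ((_root_.Ext R (ModuleCat.{u} R) j).obj (Opposite.op X)).obj Y ≃ₗ[R] Q :=
    (P.isoExt (R := R) j Y ≪≫ K.homologyIsoSc' ((ComplexShape.up ℕ).prev j) j (j + 1) rfl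
      (CochainComplex.next ℕ j) ≪≫ (K.sc' _ _ _).moduleCatHomologyIso).toLinearEquiv
  suffices e2 : Q ≃ₗ[R] Abelian.Ext.{u} X Y j from e1.trans e2
  refine (Submodule.quotEquivOfEq _ (LinearMap.ker (cocyToExt (Y := Y) P j (j + 1) rfl)) ?_).trans
    (LinearMap.quotKerEquivOfSurjective (cocyToExt (Y := Y) P j (j + 1) rfl) ?_)
  · ext f
    refine Iff.trans ?_ (extMk_eq_zero_iff' P _ j (j + 1) rfl rfl f.1 f.2).symm
    constructor
    · rintro ⟨g, hg⟩
      exact ⟨g, congrArg Subtype.val hg⟩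
    · rintro ⟨g, hg⟩
      exact ⟨g, Subtype.ext hg⟩
  · intro x
    obtain ⟨f, hf, h⟩ := P.extMk_surjective x (j + 1) rfl
    exact ⟨⟨f, hf⟩, h⟩

variable (X Y) in
/-- comparison of both Abelian.Ext. -/
def extCmp' (j : ℕ) : ((_root_.Ext R (ModuleCat.{u} R) j).obj (Opposite.op X)).obj Y ≃ₗ[R]
    Abelian.Ext.{u} X Y j := extCmp (projectiveResolution X) j

end OldExt

section LocF
set_option linter.unusedSectionVars false
set_option linter.unusedVariables false

variable {R : Type u} [CommRing R] (S : Submonoid R)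

/-- localization functor -/
abbrev locF : ModuleCat.{u} R ⥤ ModuleCat.{u} (Localization S) := ModuleCat.localizedModuleFunctor.{u} S

lemma locF_smul {X X' : ModuleCat.{u} R} (r : R) (f : X ⟶ X') :
    (locF S).map (r • f) = algebraMap R (Localization S) r • (locF S).map f := by
  apply ModuleCat.hom_ext
  ext x
  have h : (IsLocalizedModule.mapExtendScalars S (X.localizedModuleMkLinearMap S)
    (X'.localizedModuleMkLinearMap S) (Localization S) (r • f.hom)) x =
    algebraMap R (Localization S) r • (IsLocalizedModule.mapExtendScalars S (X.localizedModuleMkLinearMap S)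
    (X'.localizedModuleMkLinearMap S) (Localization S) f.hom) x := by
    rw [map_smul, algebraMap_smul]; rfl
  exact h

lemma locF_h0 [IsNoetherianRing R] (M : ModuleCat.{u} R) (N : ModuleCat.{u} R)
    (hN : Module.Finite R N) :
      (∀ f : N ⟶ M, (locF S).map f = 0 → ∃ s ∈ S, s • f = 0) ∧
      (∀ f' : (locF S).obj N ⟶ (locF S).obj M, ∃ s ∈ S, ∃ f : N ⟶ M,
        algebraMap R (Localization S) s • f' = (locF S).map f) := by
  have hfp : Module.FinitePresentation R N := Module.finitePresentation_of_finite R N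
  have hl := Module.FinitePresentation.isLocalizedModule_mapExtendScalars S
    (N.localizedModuleMkLinearMap S) (M.localizedModuleMkLinearMap S) (Localization S)
  constructor
  · intro f hf
    have h1 : IsLocalizedModule.mapExtendScalars S (N.localizedModuleMkLinearMap S)
      (M.localizedModuleMkLinearMap S) (Localization S) f.hom = 0 := 
        congrArg ModuleCat.Hom.hom hf
    obtain ⟨s, hs⟩ := (IsLocalizedModule.eq_zero_iff S (IsLocalizedModule.mapExtendScalars S (N.localizedModuleMkLinearMap S)
      (M.localizedModuleMkLinearMap S) (Localization S))).1 h1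
    exact ⟨s, s.2, ModuleCat.hom_ext hs⟩
  · intro f'
    obtain ⟨⟨f, s⟩, hs⟩ := IsLocalizedModule.surj S (IsLocalizedModule.mapExtendScalars S (N.localizedModuleMkLinearMap S)
      (M.localizedModuleMkLinearMap S) (Localization S)) f'.hom
    refine ⟨s, s.2, ModuleCat.ofHom f, ModuleCat.hom_ext ?_⟩
    refine Eq.trans ?_ hs
    ext x
    exact algebraMap_smul (M := M.localizedModule S) (Localization S) (s : R) (f'.hom x)

/-- comparison -/
def locIso (M : ModuleCat.{u} R) :
    (locF S).obj M ≅ ModuleCat.of (Localization S) (LocalizedModule S M) :=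
  (Shrink.linearEquiv.{u} (Localization S) (LocalizedModule S M)).toModuleIso

end LocF

section Fact3

variable {R : Type u} [CommRing R] {a : Ideal R}

/-- the condition `R / a ^ n ≅ E / a ^ n E` for `E = End M`. -/
def EndCond (a : Ideal R) (E : Type*) [Ring E] [Algebra R E] : Prop :=
  ∀ n : ℕ, (∀ f : E, ∃ r : R, f - r • (1 : E) ∈ (a ^ n • ⊤ : Submodule R E)) ∧
    ∀ r : R, r • (1 : E) ∈ (a ^ n • ⊤ : Submodule R E) → r ∈ a ^ n

lemma ev_le {m n : ℕ} (hmn : m ≤ n) (c : AdicCompletion a R) (r : R)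
    (h : AdicCompletion.evalₐ a n c = Ideal.Quotient.mk _ r) :
    AdicCompletion.evalₐ a m c = Ideal.Quotient.mk _ r := by
  obtain ⟨x, rfl⟩ := AdicCompletion.mk_surjective a R c
  rw [AdicCompletion.evalₐ_mk, Ideal.Quotient.eq] at h ⊢
  have h1 := x.2 hmn
  rw [SModEq.sub_mem] at h1
  have h2 : x.1 m - x.1 n ∈ a ^ m := by simpa using h1
  have := add_mem h2 (Ideal.pow_le_pow_right hmn h)
  simpa using this

lemma ev_exists (n : ℕ) (c : AdicCompletion a R) :
    ∃ r, AdicCompletion.evalₐ a n c = Ideal.Quotient.mk _ r := by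
  obtain ⟨r, hr⟩ := Ideal.Quotient.mk_surjective (AdicCompletion.evalₐ a n c)
  exact ⟨r, hr.symm⟩

lemma mem_smul_of_ev [IsNoetherianRing R] {n : ℕ} {c : AdicCompletion a R}
    (h : AdicCompletion.evalₐ a n c = 0) :
    c ∈ (a ^ n • ⊤ : Submodule R (AdicCompletion a R)) := by
  rw [AdicCompletion.pow_smul_top_eq_ker_eval (I := a) (M := R) (IsNoetherian.noetherian a),
    LinearMap.mem_ker, ← AdicCompletion.factor_evalₐ_eq_eval a c (by simp), h, map_zero]

lemma ev_of_mem_smul [IsNoetherianRing R] {n : ℕ} {c : AdicCompletion a R}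
    (h : c ∈ (a ^ n • ⊤ : Submodule R (AdicCompletion a R))) :
    AdicCompletion.evalₐ a n c = 0 := by
  rw [AdicCompletion.pow_smul_top_eq_ker_eval (I := a) (M := R) (IsNoetherian.noetherian a),
    LinearMap.mem_ker] at h
  rw [← AdicCompletion.factor_eval_eq_evalₐ a c (by simp), h, map_zero]

lemma endCond_completion [IsNoetherianRing R] (a : Ideal R) : EndCond a (AdicCompletion a R) := by
  intro n
  constructor
  · intro c
    obtain ⟨r, hr⟩ := ev_exists n c
    refine ⟨r, mem_smul_of_ev ?_⟩
    rw [map_sub, hr, map_smul, map_one, Algebra.smul_def, mul_one]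
    exact sub_self _
  · intro r hr
    have := ev_of_mem_smul hr
    rw [map_smul, map_one, Algebra.smul_def, mul_one] at this
    exact Ideal.Quotient.eq_zero_iff_mem.1 this

lemma EndCond.of_equiv {E E' : Type*} [Ring E] [Algebra R E] [Ring E'] [Algebra R E']
    (e : E ≃ₐ[R] E') (h : EndCond a E) : EndCond a E' := by
  have key : ∀ (n : ℕ) (x : E), x ∈ (a ^ n • ⊤ : Submodule R E) ↔
      e x ∈ (a ^ n • ⊤ : Submodule R E') := by
    intro n x
    have h1 : (a ^ n • ⊤ : Submodule R E').comap e.toLinearMap = (a ^ n • ⊤ : Submodule R E) := by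
      have h2 : (a ^ n • ⊤ : Submodule R E).map e.toLinearEquiv.toLinearMap =
          (a ^ n • ⊤ : Submodule R E') := by
        rw [Submodule.map_smul'', Submodule.map_top, LinearEquiv.range]
      rw [← h2]
      exact Submodule.comap_map_eq_of_injective e.injective _
    rw [← h1]; rfl
  intro n
  constructor
  · intro f
    obtain ⟨r, hr⟩ := (h n).1 (e.symm f)
    refine ⟨r, ?_⟩
    rw [key] at hr
    simpa using hr
  · intro r hr
    apply (h n).2 r
    rw [key]
    simpa using hr

variable {M : Type u} [AddCommGroup M] [Module R M]

lemma kill_of_mem {n : ℕ} {f : Module.End R M}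
    (hf : f ∈ (a ^ n • ⊤ : Submodule R (Module.End R M))) {x : M} (hx : ∀ r ∈ a ^ n, r • x = 0) :
    f x = 0 := by
  refine Submodule.smul_induction_on (p := fun f : Module.End R M => f x = 0) hf ?_ ?_
  · intro r hr g _
    rw [LinearMap.smul_apply, ← map_smul, hx r hr, map_zero]
  · intro g g' h h'
    rw [LinearMap.add_apply, h, h', add_zero]

/-- the action of the completion on a torsion module -/
def act (ht : ∀ x : M, ∃ n : ℕ, ∀ r ∈ a ^ n, r • x = 0) (c : AdicCompletion a R) (x : M) : M :=
  (ev_exists (ht x).choose c).choose • x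

lemma act_eq (ht : ∀ x : M, ∃ n : ℕ, ∀ r ∈ a ^ n, r • x = 0) (c : AdicCompletion a R) (x : M)
    (n : ℕ) (hn : ∀ r ∈ a ^ n, r • x = 0) (r : R)
    (hr : AdicCompletion.evalₐ a n c = Ideal.Quotient.mk _ r) : act ht c x = r • x := by
  obtain ⟨t, h⟩ := ev_exists (max n (ht x).choose) c
  have h1 := ev_le (le_max_left n (ht x).choose) c t h
  have h2 := ev_le (le_max_right n (ht x).choose) c t h
  have h3 := (ev_exists (ht x).choose c).choose_spec
  rw [hr, Ideal.Quotient.eq] at h1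
  rw [h3, Ideal.Quotient.eq] at h2
  have h4 := hn _ h1
  have h5 := (ht x).choose_spec _ h2
  rw [sub_smul, sub_eq_zero] at h4 h5
  rw [act, h5, h4]

lemma kill_le {m n : ℕ} (hmn : m ≤ n) {x : M} (h : ∀ r ∈ a ^ m, r • x = 0) :
    ∀ r ∈ a ^ n, r • x = 0 := fun r hr => h r (Ideal.pow_le_pow_right hmn hr)

/-- the action map. -/
def actHom (ht : ∀ x : M, ∃ n : ℕ, ∀ r ∈ a ^ n, r • x = 0) :
    AdicCompletion a R →ₐ[R] Module.End R M :=
  AlgHom.ofLinearMap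
    { toFun := fun c =>
        { toFun := act ht c
          map_add' := by
            intro x y
            obtain ⟨n, hn⟩ := ht x
            obtain ⟨m, hm⟩ := ht y
            have hn := kill_le (le_max_left n m) hn
            have hm := kill_le (le_max_right n m) hm
            obtain ⟨r, hr⟩ := ev_exists (max n m) c
            rw [act_eq ht c x _ hn r hr, act_eq ht c y _ hm r hr, act_eq ht c (x + y) _ ?_ r hr,
              smul_add]
            intro s hs
            rw [smul_add, hn s hs, hm s hs, add_zero]
          map_smul' := by
            intro s x
            obtain ⟨n, hn⟩ := ht x
            obtain ⟨r, hr⟩ := ev_exists n c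
            rw [act_eq ht c x _ hn r hr, act_eq ht c (s • x) n ?_ r hr, RingHom.id_apply, smul_comm]
            intro t h
            rw [smul_comm, hn t h, smul_zero] }
      map_add' := by
        intro c d
        ext x
        obtain ⟨n, hn⟩ := ht x
        obtain ⟨r, hr⟩ := ev_exists n c
        obtain ⟨s, hs⟩ := ev_exists n d
        refine (act_eq ht (c + d) x n hn (r + s) (by rw [map_add, hr, hs, map_add])).trans ?_
        rw [LinearMap.add_apply, add_smul]
        exact (congrArg₂ _ (act_eq ht c x n hn r hr) (act_eq ht d x n hn s hs)).symm
      map_smul' := by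
        intro s c
        ext x
        obtain ⟨n, hn⟩ := ht x
        obtain ⟨r, hr⟩ := ev_exists n c
        refine (act_eq ht (s • c) x n hn (s * r) (by rw [map_smul, hr, Algebra.smul_def]; rfl)).trans ?_
        rw [mul_smul]
        exact congrArg (s • ·) (act_eq ht c x n hn r hr).symm }
    (by
      ext x
      obtain ⟨n, hn⟩ := ht x
      refine (act_eq ht 1 x n hn 1 (by rw [map_one, map_one])).trans ?_
      rw [one_smul]; rfl)
    (by
      intro c d
      ext x
      obtain ⟨n, hn⟩ := ht x
      obtain ⟨r, hr⟩ := ev_exists n c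
      obtain ⟨s, hs⟩ := ev_exists n d
      refine (act_eq ht (c * d) x n hn (r * s) (by rw [map_mul, hr, hs, map_mul])).trans ?_
      have h1 : act ht c (act ht d x) = r • s • x := by
        rw [act_eq ht d x n hn s hs]
        refine act_eq ht c (s • x) n ?_ r hr
        intro t h
        rw [smul_comm, hn t h, smul_zero]
      rw [mul_smul]
      exact h1.symm)

lemma endCond_iff [IsNoetherianRing R] (ht : ∀ x : M, ∃ n : ℕ, ∀ r ∈ a ^ n, r • x = 0) :
    (∃ χ : AdicCompletion a R →ₐ[R] Module.End R M, Function.Bijective χ) ↔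
      EndCond a (Module.End R M) := by
  constructor
  · rintro ⟨χ, hχ⟩
    exact (endCond_completion a).of_equiv (AlgEquiv.ofBijective χ hχ)
  · intro h
    refine ⟨actHom ht, ?_, ?_⟩
    · rw [injective_iff_map_eq_zero]
      intro c hc
      refine AdicCompletion.ext_evalₐ fun n => ?_
      obtain ⟨r, hr⟩ := (endCond_completion a n).1 c
      have h1 := Submodule.mem_map_of_mem (f := (actHom ht).toLinearMap) hr
      rw [Submodule.map_smul''] at h1
      have h2 : actHom ht (c - r • 1) ∈ (a ^ n • ⊤ : Submodule R (Module.End R M)) :=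
        Submodule.smul_mono le_rfl le_top h1
      rw [map_sub, hc, map_smul, map_one, zero_sub, neg_mem_iff] at h2
      have h3 := (h n).2 r h2
      have h4 := ev_of_mem_smul hr
      rw [map_sub, sub_eq_zero, map_smul, map_one, Algebra.smul_def, mul_one] at h4
      rw [h4, map_zero]
      exact Ideal.Quotient.eq_zero_iff_mem.2 h3
    · intro f
      choose r hr using fun n => (h n).1 f
      have hc : ∀ n, r n - r (n + 1) ∈ a ^ n := by
        intro n
        apply (h n).2
        have h1 : f - r (n + 1) • 1 ∈ (a ^ n • ⊤ : Submodule R (Module.End R M)) :=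
          Submodule.smul_mono_left (Ideal.pow_le_pow_right (Nat.le_succ n)) (hr (n + 1))
        have := sub_mem h1 (hr n)
        rw [sub_smul]
        simpa using this
      refine ⟨AdicCompletion.mk a R (AdicCompletion.AdicCauchySequence.mk a R r ?_), ?_⟩
      · intro n
        rw [SModEq.sub_mem]
        simpa using hc n
      · ext x
        obtain ⟨n, hn⟩ := ht x
        refine (act_eq ht _ x n hn (r n) (AdicCompletion.evalₐ_mk _ _ _)).trans ?_
        have := kill_of_mem (hr n) hn
        rw [LinearMap.sub_apply, sub_eq_zero] at this
        exact this.symm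

end Fact3

section Glue
set_option linter.unusedSectionVars false
set_option linter.unusedVariables false

open CategoryTheory.Pretriangulated CategoryTheory.Limits

/-- module version of `EndCond`. -/
def EC {A : Type*} [CommRing A] (a : Ideal A) {H : Type*} [AddCommGroup H] [Module A H] (h0 : H) : Prop :=
  ∀ n : ℕ, (∀ f : H, ∃ r : A, f - r • h0 ∈ (a ^ n • ⊤ : Submodule A H)) ∧
    ∀ r : A, r • h0 ∈ (a ^ n • ⊤ : Submodule A H) → r ∈ a ^ n

lemma EC.of_equiv {A : Type*} [CommRing A] {a : Ideal A} {H H' : Type*} [AddCommGroup H]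
    [Module A H] [AddCommGroup H'] [Module A H'] {h0 : H}
    (e : H ≃ₗ[A] H') (h : EC a h0) : EC a (e h0) := by
  have key : ∀ (n : ℕ) (x : H), x ∈ (a ^ n • ⊤ : Submodule A H) ↔
      e x ∈ (a ^ n • ⊤ : Submodule A H') := by
    intro n x
    have h1 : (a ^ n • ⊤ : Submodule A H').comap e.toLinearMap = (a ^ n • ⊤ : Submodule A H) := by
      have h2 : (a ^ n • ⊤ : Submodule A H).map e.toLinearMap =
          (a ^ n • ⊤ : Submodule A H') := by
        rw [Submodule.map_smul'', Submodule.map_top, LinearEquiv.range]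
      rw [← h2]
      exact Submodule.comap_map_eq_of_injective e.injective _
    rw [← h1]; rfl
  intro n
  constructor
  · intro f
    obtain ⟨r, hr⟩ := (h n).1 (e.symm f)
    refine ⟨r, ?_⟩
    rw [key] at hr
    simpa using hr
  · intro r hr
    apply (h n).2 r
    rw [key]
    simpa using hr

variable {A : Type*} [CommRing A] {C : Type*} [Category C] [Preadditive C] [HasZeroObject C]
  [HasShift C ℤ] [∀ n : ℤ, (shiftFunctor C n).Additive] [Pretriangulated C] [Linear A C]

/-- derived version of the property -/
def SD (a : Ideal A) (Y : C) : Prop := Van Y Y ∧ EC a (𝟙 Y)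

lemma SD.of_iso {a : Ideal A} {Y Y' : C} (e : Y ≅ Y') (h : SD a Y) : SD a Y' := by
  refine ⟨fun m hm f => ?_, ?_⟩
  · have h1 := h.1 m hm ((shiftFunctor C (-m)).map e.hom ≫ f ≫ e.inv)
    have h2 : f ≫ e.inv = 0 := zero_of_epi_comp _ h1
    exact zero_of_comp_mono _ h2
  · have := EC.of_equiv (Linear.homCongr A e e) h.2
    convert this using 1
    simp [Linear.homCongr]

/-- the condition on a tower -/
def PC (b : Ideal A) {X Y : C} (π : X ⟶ Y) : Prop :=
  (∀ f : X ⟶ Y, ∃ r : A, f = r • π) ∧ ∀ r : A, r • π = 0 → r ∈ b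

lemma PC_iff {Y : C} (hv : Van Y Y) {xs : List A} {X : C} {π : X ⟶ Y} (ht : Tower A Y xs X π)
    (b : Ideal A) (hb : Ideal.span {x | x ∈ xs} = b) :
    PC b π ↔ (∀ f : Y ⟶ Y, ∃ r : A, f - r • 𝟙 Y ∈ (b • ⊤ : Submodule A (Y ⟶ Y))) ∧
      ∀ r : A, r • 𝟙 Y ∈ (b • ⊤ : Submodule A (Y ⟶ Y)) → r ∈ b := by
  obtain ⟨h1, h2⟩ := ht.quot hv
  rw [hb] at h2
  constructor
  · rintro ⟨p1, p2⟩
    constructor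
    · intro f
      obtain ⟨r, hr⟩ := p1 (π ≫ f)
      refine ⟨r, (h2 _).1 ?_⟩
      rw [Preadditive.comp_sub, hr, Linear.comp_smul, Category.comp_id, sub_self]
    · intro r hr
      have := (h2 _).2 hr
      rw [Linear.comp_smul, Category.comp_id] at this
      exact p2 r this
  · rintro ⟨p1, p2⟩
    constructor
    · intro f
      obtain ⟨φ, rfl⟩ := h1 f
      obtain ⟨r, hr⟩ := p1 φ
      have := (h2 _).2 hr
      rw [Preadditive.comp_sub, Linear.comp_smul, Category.comp_id, sub_eq_zero] at this
      exact ⟨r, this⟩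
    · intro r hr
      refine p2 r ((h2 _).1 ?_)
      rw [Linear.comp_smul, Category.comp_id, hr]

lemma SD_iff [∀ n : ℤ, (shiftFunctor C n).Linear A] (a : Ideal A) (Y : C) (xs : ℕ → List A)
    (hxs : ∀ n, Ideal.span {x | x ∈ xs n} = a ^ n) (X : ℕ → C) (π : ∀ n, X n ⟶ Y)
    (ht : ∀ n, Tower A Y (xs n) (X n) (π n)) (hd : ∀ x ∈ a, ∀ n : ℤ, DC x (Y⟦n⟧ ⟶ Y)) :
    SD a Y ↔ Van Y (X 1) ∧ ∀ n, PC (a ^ n) (π n) := by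
  constructor
  · rintro ⟨hv, he⟩
    exact ⟨(ht 1).van hv, fun n => (PC_iff hv (ht n) _ (hxs n)).2 (he n)⟩
  · rintro ⟨hv, he⟩
    have hv' : Van Y Y := by
      refine (ht 1).van_conv (fun x hx => hd x ?_) hv
      have : x ∈ Ideal.span {x | x ∈ xs 1} := Ideal.subset_span hx
      rwa [hxs 1, pow_one] at this
    exact ⟨hv', fun n => (PC_iff hv' (ht n) _ (hxs n)).1 (he n)⟩

variable {A' : Type*} [CommRing A'] [Algebra A A'] {C' : Type*} [Category C'] [Preadditive C']
  [HasZeroObject C']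
  [HasShift C' ℤ] [∀ n : ℤ, (shiftFunctor C' n).Additive] [Pretriangulated C'] [Linear A' C']
  (L : C ⥤ C') [L.CommShift ℤ] [L.IsTriangulated] [L.Additive] (S : Submonoid A) [IsLocalization S A']
  (hL : ∀ {X X' : C} (r : A) (f : X ⟶ X'), L.map (r • f) = algebraMap A A' r • L.map f)

lemma unit_smul_zero (H : Type*) [AddCommGroup H] [Module A' H] {s : A} (hs : s ∈ S) {h : H}
    (hh : algebraMap A A' s • h = 0) : h = 0 := by
  have hu : IsUnit (algebraMap A A' s) := IsLocalization.map_units A' ⟨s, hs⟩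
  exact (hu.smul_eq_zero).1 hh

include hL in
lemma PC_loc {X Y : C} {π : X ⟶ Y} (b : Ideal A) (h1 : LInj L S Y X)
    (h2 : LSurj L (algebraMap A A') S Y X) (h : PC b π) :
    PC (b.map (algebraMap A A')) (L.map π) := by
  constructor
  · intro f'
    obtain ⟨s, hs, f, hf⟩ := h2 f'
    obtain ⟨r, rfl⟩ := h.1 f
    refine ⟨IsLocalization.mk' A' r ⟨s, hs⟩, ?_⟩
    rw [hL] at hf
    rw [← sub_eq_zero]
    refine unit_smul_zero (A' := A') S _ hs ?_
    rw [smul_sub, hf, smul_smul, ← IsLocalization.mk'_spec_mk A' r s hs, mul_comm, sub_self]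
  · intro r' hr
    obtain ⟨⟨r, s⟩, hrs⟩ := IsLocalization.surj S r'
    have h3 : L.map (r • π) = 0 := by
      rw [hL]
      rw [← hrs, mul_comm, mul_smul, hr, smul_zero]
    obtain ⟨t, ht, h4⟩ := h1 _ h3
    rw [smul_smul] at h4
    have h5 := Ideal.mem_map_of_mem (algebraMap A A') (h.2 _ h4)
    rw [map_mul, ← hrs] at h5
    have hu : IsUnit (algebraMap A A' t) := IsLocalization.map_units A' ⟨t, ht⟩
    have hu' : IsUnit (algebraMap A A' s) := IsLocalization.map_units A' s
    rw [Ideal.unit_mul_mem_iff_mem _ hu, mul_comm, Ideal.unit_mul_mem_iff_mem _ hu'] at h5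
    exact h5

include hL in
lemma PC_back1 {X Y : C} {π : X ⟶ Y} (b : Ideal A') (h1 : LInj L S Y X)
    (h : PC b (L.map π)) (f : X ⟶ Y) : ∃ s ∈ S, ∃ r : A, s • f = r • π := by
  obtain ⟨r', hr'⟩ := h.1 (L.map f)
  obtain ⟨⟨r, s⟩, hrs⟩ := IsLocalization.surj S r'
  have h3 : L.map ((s : A) • f - r • π) = 0 := by
    rw [L.map_sub, hL, hL, hr', ← hrs, smul_smul, mul_comm, sub_self]
  obtain ⟨t, ht, h4⟩ := h1 _ h3
  refine ⟨t * s, S.mul_mem ht s.2, t * r, ?_⟩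
  rw [smul_sub, sub_eq_zero] at h4
  rw [mul_smul, mul_smul, h4]

include hL in
lemma PC_back2 {X Y : C} {π : X ⟶ Y} (b : Ideal A)
    (h : PC (b.map (algebraMap A A')) (L.map π)) (r : A) (hr : r • π = 0) :
    ∃ s ∈ S, s * r ∈ b := by
  have h1 := h.2 (algebraMap A A' r) (by rw [← hL, hr, L.map_zero])
  obtain ⟨m, hm, h⟩ := (IsLocalization.algebraMap_mem_map_algebraMap_iff S A' b r).1 h1
  exact ⟨m, hm, h⟩

lemma Van_loc {X Y : C} (h1 : ∀ n : ℤ, LSurj L (algebraMap A A') S Y (X⟦n⟧)) (h : Van Y X) :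
    Van (L.obj Y) (L.obj X) := by
  intro m hm f'
  obtain ⟨s, hs, f, hf⟩ := h1 (-m) ((L.commShiftIso (-m)).hom.app X ≫ f')
  rw [h m hm f, L.map_zero] at hf
  exact zero_of_epi_comp _ (unit_smul_zero S _ hs hf)

lemma Van_back {X Y : C} (h1 : ∀ n : ℤ, LInj L S Y (X⟦n⟧)) (h : Van (L.obj Y) (L.obj X))
    (m : ℤ) (hm : 0 < m) (f : X⟦-m⟧ ⟶ Y) : ∃ s ∈ S, s • f = 0 := by
  refine h1 (-m) f ?_
  exact zero_of_epi_comp ((L.commShiftIso (-m)).inv.app X) (h m hm _)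

end Glue

section AssemblyM
set_option linter.unusedSectionVars false
set_option linter.unusedVariables false

open CategoryTheory.Pretriangulated CategoryTheory.Limits DerivedCategory

universe w w'

section one
variable {R : Type u} [CommRing R] [HasDerivedCategory.{w} (ModuleCat.{u} R)]

/-- shifted homs and Ext -/
def homExt (N M : ModuleCat.{u} R) (i : ℕ) :
    (((singleFunctor _ 0).obj N)⟦(-(i : ℤ))⟧ ⟶ (singleFunctor (ModuleCat.{u} R) 0).obj M) ≃ₗ[R]
      (((_root_.Ext R (ModuleCat.{u} R) i).obj (Opposite.op N)).obj M) :=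
  (shiftHomEquiv R _ _ (i : ℤ)).trans
    ((Abelian.Ext.homLinearEquiv (R := R) (X := N) (Y := M) (n := i)).symm.trans
      (extCmp' N M i).symm)

lemma van_iff (M : ModuleCat.{u} R) :
    Van ((singleFunctor _ 0).obj M) ((singleFunctor _ 0).obj M) ↔
      ∀ i : ℕ, 1 ≤ i →
        Subsingleton (((_root_.Ext R (ModuleCat.{u} R) i).obj (Opposite.op M)).obj M) := by
  constructor
  · intro h i hi
    have : Subsingleton (((singleFunctor _ 0).obj M)⟦(-(i : ℤ))⟧ ⟶
        (singleFunctor (ModuleCat.{u} R) 0).obj M) :=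
      ⟨fun f g => by rw [h i (by omega) f, h i (by omega) g]⟩
    exact (homExt M M i).symm.toEquiv.subsingleton
  · intro h m hm f
    obtain ⟨i, rfl⟩ := Int.eq_ofNat_of_zero_le hm.le
    have := h i (by omega)
    have := (homExt M M i).toEquiv.subsingleton
    exact Subsingleton.elim _ _

lemma SD_module [IsNoetherianRing R] (a : Ideal R) (M : Type u) [AddCommGroup M] [Module R M]
    (ht : IsAdicTorsion R a M) :
    SD a ((singleFunctor _ 0).obj (ModuleCat.of R M)) ↔
      (∃ χ : AdicCompletion a R →ₐ[R] Module.End R M, Function.Bijective χ) ∧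
      ∀ i : ℕ, 1 ≤ i → Subsingleton (extMod R i M M) := by
  rw [endCond_iff ht, and_comm]
  refine and_congr (van_iff _) ?_
  let e : Module.End R M ≃ₗ[R] ((singleFunctor _ 0).obj (ModuleCat.of R M) ⟶
      (singleFunctor (ModuleCat.{u} R) 0).obj (ModuleCat.of R M)) :=
    (ModuleCat.homLinearEquiv (S := R) (M := ModuleCat.of R M) (N := ModuleCat.of R M)).symm.trans
      (singleHomEquiv _ _)
  have he : e 1 = 𝟙 _ := (singleFunctor (ModuleCat.{u} R) 0).map_id _
  constructor
  · intro h
    have := EC.of_equiv e.symm h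
    rw [← he, e.symm_apply_apply] at this
    exact this
  · intro h
    have := EC.of_equiv (h0 := (1 : Module.End R M)) e h
    rwa [he] at this
end one

section two
variable {A : Type*} [CommRing A] {C : Type*} [Category C] [Preadditive C] [Linear A C]
variable {A' : Type*} [CommRing A'] [Algebra A A'] {C' : Type*} [Category C'] [Preadditive C']
  [Linear A' C'] (L : C ⥤ C') [L.Additive] (S : Submonoid A) [IsLocalization S A']
  (hL : ∀ {X X' : C} (r : A) (f : X ⟶ X'), L.map (r • f) = algebraMap A A' r • L.map f)

include hL in
lemma fin_loc (X Y : C) (h : LSurj L (algebraMap A A') S Y X) [hf : Module.Finite A (X ⟶ Y)] :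
    Module.Finite A' (L.obj X ⟶ L.obj Y) := by
  classical
  obtain ⟨t, ht⟩ := hf.fg_top
  refine ⟨⟨t.image (fun f => L.map f), ?_⟩⟩
  rw [eq_top_iff]
  intro f' _
  obtain ⟨s, hs, f, hf⟩ := h f'
  have h1 : ∀ f : X ⟶ Y, f ∈ Submodule.span A (t : Set (X ⟶ Y)) →
      L.map f ∈ Submodule.span A' ((t.image (fun f => L.map f) : Finset _) :
        Set (L.obj X ⟶ L.obj Y)) := by
    intro f hf
    induction hf using Submodule.span_induction with
    | mem x hx => exact Submodule.subset_span (Finset.mem_coe.2 (Finset.mem_image_of_mem _ hx))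
    | zero => rw [L.map_zero]; exact Submodule.zero_mem _
    | add x y _ _ hx hy => rw [L.map_add]; exact Submodule.add_mem _ hx hy
    | smul r x _ hx => rw [hL]; exact Submodule.smul_mem _ _ hx
  have h2 := h1 f (by rw [ht]; trivial)
  rw [← hf] at h2
  have hu : IsUnit (algebraMap A A' s) := IsLocalization.map_units A' ⟨s, hs⟩
  obtain ⟨v, hv⟩ := hu.exists_left_inv
  have h3 := Submodule.smul_mem _ v h2
  rwa [smul_smul, hv, one_smul] at h3
end two

section three
variable {R : Type u} [CommRing R] [IsNoetherianRing R] (S : Submonoid R)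
  [HasDerivedCategory.{w} (ModuleCat.{u} R)]
  [HasDerivedCategory.{w'} (ModuleCat.{u} (Localization S))]

/-- localization of `R/a` -/
def quotLocIso (a : Ideal R) : (locF S).obj (ModuleCat.of R (R ⧸ a)) ≅
    ModuleCat.of (Localization S)
      (Localization S ⧸ a.map (algebraMap R (Localization S))) :=
  locIso S _ ≪≫ ((LocalizedModule.equivTensorProduct S (R ⧸ a)).trans
    (Algebra.TensorProduct.quotIdealMapEquivTensorQuot (Localization S) a).symm.toLinearEquiv).toModuleIso

/-- derived localization of a module. -/
def LIso (N : ModuleCat.{u} R) (N' : ModuleCat.{u} (Localization S)) (e : (locF S).obj N ≅ N')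
    (n : ℤ) :
    (locF S).mapDerivedCategory.obj (((singleFunctor _ 0).obj N)⟦n⟧) ≅
      ((singleFunctor _ 0).obj N')⟦n⟧ :=
  LsingleIso (locF S) N n ≪≫ (shiftFunctor _ n).mapIso ((singleFunctor _ 0).mapIso e)

/-- derived localization of a module, no shift. -/
def LIso0 (N : ModuleCat.{u} R) (N' : ModuleCat.{u} (Localization S)) (e : (locF S).obj N ≅ N') :
    (locF S).mapDerivedCategory.obj ((singleFunctor _ 0).obj N) ≅
      (singleFunctor _ 0).obj N' :=
  ((locF S).mapDerivedCategorySingleFunctor 0).app N ≪≫ (singleFunctor _ 0).mapIso e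

lemma ext_loc_finite (N M : ModuleCat.{u} R) (hN : Module.Finite R N)
    (N' M' : ModuleCat.{u} (Localization S)) (eN : (locF S).obj N ≅ N')
    (eM : (locF S).obj M ≅ M') (i : ℕ)
    (h : Module.Finite R (((_root_.Ext R (ModuleCat.{u} R) i).obj (Opposite.op N)).obj M)) :
    Module.Finite (Localization S)
      (((_root_.Ext (Localization S) (ModuleCat.{u} (Localization S)) i).obj
        (Opposite.op N')).obj M') := by
  have h1 := Module.Finite.equiv (homExt N M i).symm
  have h2 := LLoc_finite (locF S) (algebraMap R (Localization S)) S (locF_smul S) M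
    (locF_h0 S M) N hN (-(i : ℤ))
  have h3 := fin_loc (locF S).mapDerivedCategory S
    (semilinear (locF S) (algebraMap R (Localization S)) (locF_smul S)) _ _ h2.2
  have h4 := Module.Finite.equiv
    (Linear.homCongr (Localization S) (LIso S N N' eN (-(i : ℤ))) (LIso0 S M M' eM))
  exact Module.Finite.equiv (homExt N' M' i)

lemma torsion_loc (a : Ideal R) (M : Type u) [AddCommGroup M] [Module R M]
    (ht : IsAdicTorsion R a M) :
    IsAdicTorsion (Localization S) (a.map (algebraMap R (Localization S)))
      (LocalizedModule S M) := by
  intro x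
  induction x using LocalizedModule.induction_on with
  | h m s =>
    obtain ⟨n, hn⟩ := ht m
    refine ⟨n, fun r hr => ?_⟩
    rw [← Ideal.map_pow] at hr
    have hr' : r ∈ Submodule.span _ (algebraMap R (Localization S) '' ((a ^ n : Ideal R) : Set R)) := hr
    induction hr' using Submodule.span_induction with
    | mem x hx =>
      obtain ⟨y, hy, rfl⟩ := hx
      rw [algebraMap_smul, LocalizedModule.smul'_mk, hn y hy, LocalizedModule.zero_mk]
    | zero => rw [zero_smul]
    | add x y hx' hy' hx hy => rw [add_smul, hx hx', hy hy', add_zero]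
    | smul r x hx' hx => rw [smul_eq_mul, mul_smul, hx hx', smul_zero]

end three

end AssemblyM

section AssemblyN
set_option linter.unusedSectionVars false
set_option linter.unusedVariables false

open CategoryTheory.Pretriangulated CategoryTheory.Limits DerivedCategory

universe w w'

variable {R : Type u} [CommRing R] [IsNoetherianRing R]
  [HasDerivedCategory.{w} (ModuleCat.{u} R)]

lemma exists_gens (a : Ideal R) : ∃ xs : ℕ → List R, ∀ n, Ideal.span {x | x ∈ xs n} = a ^ n := by
  have : ∀ n, ∃ l : List R, Ideal.span {x | x ∈ l} = a ^ n := by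
    intro n
    obtain ⟨t, ht⟩ := (IsNoetherian.noetherian (a ^ n) : (a ^ n).FG)
    refine ⟨t.toList, ?_⟩
    rw [← ht]
    congr 1
    ext x
    simp
  choose xs h using this
  exact ⟨xs, h⟩

lemma SD_base (a : Ideal R) (M : Type u) [AddCommGroup M] [Module R M]
    (htor : IsAdicTorsion R a M) (xs : ℕ → List R)
    (hxs : ∀ n, Ideal.span {x | x ∈ xs n} = a ^ n)
    (X : ℕ → DerivedCategory (ModuleCat.{u} R))
    (π : ∀ n, X n ⟶ (singleFunctor _ 0).obj (ModuleCat.of R M))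
    (ht : ∀ n, Tower R ((singleFunctor _ 0).obj (ModuleCat.of R M)) (xs n) (X n) (π n)) :
    SD a ((singleFunctor _ 0).obj (ModuleCat.of R M)) ↔
      Van ((singleFunctor _ 0).obj (ModuleCat.of R M)) (X 1) ∧ ∀ n, PC (a ^ n) (π n) := by
  refine SD_iff a _ xs hxs X π ht fun x hx n => DC_single x _ _ (fun y => ?_) n
  obtain ⟨k, hk⟩ := htor y
  exact ⟨k, hk _ (Ideal.pow_mem_pow hx k)⟩

lemma SD_local (S : Submonoid R) [HasDerivedCategory.{w'} (ModuleCat.{u} (Localization S))]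
    (a : Ideal R) (M : Type u) [AddCommGroup M] [Module R M]
    (htor : IsAdicTorsion R a M) (xs : ℕ → List R)
    (hxs : ∀ n, Ideal.span {x | x ∈ xs n} = a ^ n)
    (X : ℕ → DerivedCategory (ModuleCat.{u} R))
    (π : ∀ n, X n ⟶ (singleFunctor _ 0).obj (ModuleCat.of R M))
    (ht : ∀ n, Tower R ((singleFunctor _ 0).obj (ModuleCat.of R M)) (xs n) (X n) (π n)) :
    SD (a.map (algebraMap R (Localization S)))
      ((singleFunctor _ 0).obj (ModuleCat.of (Localization S) (LocalizedModule S M))) ↔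
      Van ((locF S).mapDerivedCategory.obj ((singleFunctor _ 0).obj (ModuleCat.of R M)))
        ((locF S).mapDerivedCategory.obj (X 1)) ∧
      ∀ n, PC ((a ^ n).map (algebraMap R (Localization S)))
        ((locF S).mapDerivedCategory.map (π n)) := by
  have htor' := torsion_loc S a M htor
  let e := LIso0 S (ModuleCat.of R M) _ (locIso S (ModuleCat.of R M))
  have h1 : SD (a.map (algebraMap R (Localization S)))
      ((singleFunctor _ 0).obj (ModuleCat.of (Localization S) (LocalizedModule S M))) ↔
      SD (a.map (algebraMap R (Localization S)))
        ((locF S).mapDerivedCategory.obj ((singleFunctor _ 0).obj (ModuleCat.of R M))) :=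
    ⟨fun h => h.of_iso e.symm, fun h => h.of_iso e⟩
  rw [h1]
  simp only [Ideal.map_pow]
  refine SD_iff _ _ (fun n => (xs n).map (algebraMap R (Localization S))) ?_
    (fun n => (locF S).mapDerivedCategory.obj (X n))
    (fun n => (locF S).mapDerivedCategory.map (π n))
    (fun n => (ht n).map (semilinear (locF S) (algebraMap R (Localization S)) (locF_smul S))) ?_
  · intro n
    rw [← Ideal.map_pow, ← hxs n, Ideal.map_span]
    congr 1
    ext x
    simp
  · intro x hx n
    have h2 : DC x (((singleFunctor _ 0).obj (ModuleCat.of (Localization S)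
        (LocalizedModule S M)))⟦n⟧ ⟶ (singleFunctor _ 0).obj (ModuleCat.of (Localization S)
        (LocalizedModule S M))) := by
      refine DC_single x _ _ (fun y => ?_) n
      obtain ⟨k, hk⟩ := htor' y
      exact ⟨k, hk _ (Ideal.pow_mem_pow hx k)⟩
    exact h2.of_equiv
      (Linear.homCongr (Localization S) ((shiftFunctor _ n).mapIso e.symm) e.symm)

lemma gens_rad {a : Ideal R} {xs : ℕ → List R}
    (hxs : ∀ n, Ideal.span {x | x ∈ xs n} = a ^ n) (n : ℕ) :
    a ≤ (Ideal.span {x | x ∈ xs n}).radical := by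
  rw [hxs n]
  intro x hx
  exact ⟨n, Ideal.pow_mem_pow hx n⟩

lemma LLoc_X (S : Submonoid R) [HasDerivedCategory.{w'} (ModuleCat.{u} (Localization S))]
    (a : Ideal R) (M : Type u) [AddCommGroup M] [Module R M]
    (hfin : ∀ i : ℕ, Module.Finite R (extMod R i (R ⧸ a) M)) (xs : ℕ → List R)
    (hxs : ∀ n, Ideal.span {x | x ∈ xs n} = a ^ n)
    (X : ℕ → DerivedCategory (ModuleCat.{u} R))
    (π : ∀ n, X n ⟶ (singleFunctor _ 0).obj (ModuleCat.of R M))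
    (ht : ∀ n, Tower R ((singleFunctor _ 0).obj (ModuleCat.of R M)) (xs n) (X n) (π n))
    (n : ℕ) (k : ℤ) :
    LLoc (locF S) (algebraMap R (Localization S)) S
      ((singleFunctor _ 0).obj (ModuleCat.of R M)) ((X n)⟦k⟧) := by
  refine LLoc_tower (locF S) _ S (locF_smul S) _ (locF_h0 S _) a (fun i => ?_) (ht n)
    (gens_rad hxs n) k
  have := hfin i
  exact Module.Finite.equiv (extCmp' (ModuleCat.of R (R ⧸ a)) (ModuleCat.of R M) i)

lemma SD_forward (S : Submonoid R) [HasDerivedCategory.{w'} (ModuleCat.{u} (Localization S))]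
    (a : Ideal R) (M : Type u) [AddCommGroup M] [Module R M]
    (htor : IsAdicTorsion R a M)
    (hfin : ∀ i : ℕ, Module.Finite R (extMod R i (R ⧸ a) M))
    (h : SD a ((singleFunctor _ 0).obj (ModuleCat.of R M))) :
    SD (a.map (algebraMap R (Localization S)))
      ((singleFunctor _ 0).obj (ModuleCat.of (Localization S) (LocalizedModule S M))) := by
  obtain ⟨xs, hxs⟩ := exists_gens a
  choose X π ht using fun n => Tower.exists (A := R)
    ((singleFunctor (ModuleCat.{u} R) 0).obj (ModuleCat.of R M)) (xs n)
  rw [SD_base a M htor xs hxs X π ht] at h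
  rw [SD_local S a M htor xs hxs X π ht]
  have hl := LLoc_X S a M hfin xs hxs X π ht
  have hl0 := fun n => LLoc_iso (locF S) (algebraMap R (Localization S)) S
    ((singleFunctor (ModuleCat.{u} R) 0).obj (ModuleCat.of R M))
    ((shiftFunctorZero _ ℤ).app (X n)) (hl n 0)
  refine ⟨Van_loc _ S (fun n => (hl 1 n).2) h.1, fun n => ?_⟩
  exact PC_loc _ S (semilinear (locF S) (algebraMap R (Localization S)) (locF_smul S)) _
    (hl0 n).1 (hl0 n).2 (h.2 n)

lemma mem_of_local {H : Type*} [AddCommGroup H] [Module R H] (P : Submodule R H) (f : H)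
    (h : ∀ m : Ideal R, m.IsMaximal → ∃ s ∉ m, s • f ∈ P) : f ∈ P := by
  have h1 : (1 : R) ∈ P.comap (LinearMap.toSpanSingleton R H f) := by
    by_contra hJ
    obtain ⟨m, hm, hle⟩ := Ideal.exists_le_maximal (P.comap (LinearMap.toSpanSingleton R H f))
      (fun h => hJ (by rw [h]; trivial))
    obtain ⟨s, hs, hs'⟩ := h m hm
    exact hs (hle (by simpa using hs'))
  simpa using h1

lemma exists_pow_notMem {a m : Ideal R} (hm : m.IsMaximal) (h : ¬ a ≤ m) (k : ℕ) :
    ∃ s ∉ m, s ∈ a ^ k := by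
  by_contra hc
  push Not at hc
  refine h (hm.isPrime.le_of_pow_le (n := k) fun x hx => ?_)
  by_contra hx'
  exact hc x hx' hx

lemma back_van (S : Submonoid R) [HasDerivedCategory.{w'} (ModuleCat.{u} (Localization S))]
    (a : Ideal R) (M : Type u) [AddCommGroup M] [Module R M]
    (hfin : ∀ i : ℕ, Module.Finite R (extMod R i (R ⧸ a) M)) (xs : ℕ → List R)
    (hxs : ∀ n, Ideal.span {x | x ∈ xs n} = a ^ n)
    (X : ℕ → DerivedCategory (ModuleCat.{u} R))
    (π : ∀ n, X n ⟶ (singleFunctor _ 0).obj (ModuleCat.of R M))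
    (ht : ∀ n, Tower R ((singleFunctor _ 0).obj (ModuleCat.of R M)) (xs n) (X n) (π n))
    (h : Van ((locF S).mapDerivedCategory.obj ((singleFunctor _ 0).obj (ModuleCat.of R M)))
        ((locF S).mapDerivedCategory.obj (X 1))) (i : ℤ) (hi : 0 < i)
    (f : (X 1)⟦-i⟧ ⟶ (singleFunctor _ 0).obj (ModuleCat.of R M)) : ∃ s ∈ S, s • f = 0 :=
  Van_back _ S (fun n => (LLoc_X S a M hfin xs hxs X π ht 1 n).1) h i hi f

lemma back_pc1 (S : Submonoid R) [HasDerivedCategory.{w'} (ModuleCat.{u} (Localization S))]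
    (a : Ideal R) (M : Type u) [AddCommGroup M] [Module R M]
    (hfin : ∀ i : ℕ, Module.Finite R (extMod R i (R ⧸ a) M)) (xs : ℕ → List R)
    (hxs : ∀ n, Ideal.span {x | x ∈ xs n} = a ^ n)
    (X : ℕ → DerivedCategory (ModuleCat.{u} R))
    (π : ∀ n, X n ⟶ (singleFunctor _ 0).obj (ModuleCat.of R M))
    (ht : ∀ n, Tower R ((singleFunctor _ 0).obj (ModuleCat.of R M)) (xs n) (X n) (π n))
    (n : ℕ) (h : PC ((a ^ n).map (algebraMap R (Localization S)))
        ((locF S).mapDerivedCategory.map (π n)))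
    (f : X n ⟶ (singleFunctor _ 0).obj (ModuleCat.of R M)) :
    ∃ s ∈ S, ∃ r : R, s • f = r • π n := by
  have hl0 := LLoc_iso (locF S) (algebraMap R (Localization S)) S
    ((singleFunctor (ModuleCat.{u} R) 0).obj (ModuleCat.of R M))
    ((shiftFunctorZero _ ℤ).app (X n)) (LLoc_X S a M hfin xs hxs X π ht n 0)
  exact PC_back1 _ S (semilinear (locF S) (algebraMap R (Localization S)) (locF_smul S)) _
    hl0.1 h f

lemma back_pc2 (S : Submonoid R) [HasDerivedCategory.{w'} (ModuleCat.{u} (Localization S))]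
    (b : Ideal R) {X Y : DerivedCategory (ModuleCat.{u} R)} (π : X ⟶ Y)
    (h : PC (b.map (algebraMap R (Localization S))) ((locF S).mapDerivedCategory.map π))
    (r : R) (hr : r • π = 0) : ∃ s ∈ S, s * r ∈ b :=
  PC_back2 (locF S).mapDerivedCategory S
    (semilinear (locF S) (algebraMap R (Localization S)) (locF_smul S)) _ h r hr

/-- being local-semidualizing, over all maximal ideals -/
lemma SD_backward
    (a : Ideal R) (M : Type u) [AddCommGroup M] [Module R M]
    (htor : IsAdicTorsion R a M)
    (hfin : ∀ i : ℕ, Module.Finite R (extMod R i (R ⧸ a) M))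
    (h : ∀ (m : Ideal R), m.IsMaximal → a ≤ m → ∃ S : Submonoid R, (∀ s ∈ S, s ∉ m) ∧
      ∃ _ : HasDerivedCategory.{w'} (ModuleCat.{u} (Localization S)),
      SD (a.map (algebraMap R (Localization S)))
      ((singleFunctor _ 0).obj (ModuleCat.of (Localization S) (LocalizedModule S M)))) :
    SD a ((singleFunctor _ 0).obj (ModuleCat.of R M)) := by
  obtain ⟨xs, hxs⟩ := exists_gens a
  choose X π ht using fun n => Tower.exists (A := R)
    ((singleFunctor (ModuleCat.{u} R) 0).obj (ModuleCat.of R M)) (xs n)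
  rw [SD_base a M htor xs hxs X π ht]
  have hk := fun n => (ht n).ann a (gens_rad hxs n)
  refine ⟨fun i hi f => ?_, fun n => ⟨fun f => ?_, fun r hr => ?_⟩⟩
  · refine (Submodule.mem_bot R).1 (mem_of_local ⊥ f fun m hm => ?_)
    by_cases hma : a ≤ m
    · obtain ⟨S, hS, hD, h'⟩ := h m hm hma
      rw [SD_local S a M htor xs hxs X π ht] at h'
      obtain ⟨s, hs, hs'⟩ := back_van S a M hfin xs hxs X π ht h'.1 i hi f
      exact ⟨s, hS s hs, (Submodule.mem_bot R).2 hs'⟩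
    · obtain ⟨k, hk⟩ := hk 1
      obtain ⟨s, hs, hs'⟩ := exists_pow_notMem hm hma k
      exact ⟨s, hs, (Submodule.mem_bot R).2 (smul_zero_of_id (smul_id_shift (hk s hs') _) f)⟩
  · have h1 : f ∈ Submodule.span R {π n} := by
      refine mem_of_local _ f fun m hm => ?_
      by_cases hma : a ≤ m
      · obtain ⟨S, hS, hD, h'⟩ := h m hm hma
        rw [SD_local S a M htor xs hxs X π ht] at h'
        obtain ⟨s, hs, r, hr⟩ := back_pc1 S a M hfin xs hxs X π ht n (h'.2 n) f
        exact ⟨s, hS s hs, Submodule.mem_span_singleton.2 ⟨r, hr.symm⟩⟩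
      · obtain ⟨k, hk⟩ := hk n
        obtain ⟨s, hs, hs'⟩ := exists_pow_notMem hm hma k
        refine ⟨s, hs, ?_⟩
        rw [smul_zero_of_id (hk s hs') f]
        exact Submodule.zero_mem _
    obtain ⟨r, hr⟩ := Submodule.mem_span_singleton.1 h1
    exact ⟨r, hr.symm⟩
  · refine mem_of_local (a ^ n) r fun m hm => ?_
    by_cases hma : a ≤ m
    · obtain ⟨S, hS, hD, h'⟩ := h m hm hma
      rw [SD_local S a M htor xs hxs X π ht] at h'
      obtain ⟨s, hs, hs'⟩ := back_pc2 S _ (π n) (h'.2 n) r hr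
      exact ⟨s, hS s hs, hs'⟩
    · obtain ⟨s, hs, hs'⟩ := exists_pow_notMem hm hma n
      exact ⟨s, hs, Ideal.mul_mem_right _ _ hs'⟩

end AssemblyN

end ASL

/-- The adic semidualizing property is local:  let `M` be an `a`-adically finite module
(`a`-torsion with `Ext^i_R(R/a, M)` finitely generated for all `i`) over a commutative
noetherian ring `R` with `a` proper.  If `M` is `a`-adically semidualizing then for every prime
`p ⊇ a` the localization `M_p` is `a_p`-adically semidualizing over `R_p`; moreover `M` is
`a`-adically semidualizing over `R` if and only if `M_m` is `a_m`-adically semidualizing over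
`R_m` for every maximal ideal `m ⊇ a`. -/
theorem isAdicSemidualizing_is_local
    (R : Type u) [CommRing R] [IsNoetherianRing R] (a : Ideal R) (ha : a ≠ ⊤)
    (M : Type u) [AddCommGroup M] [Module R M]
    (htor : IsAdicTorsion R a M)
    (hfin : ∀ i : ℕ, Module.Finite R (extMod R i (R ⧸ a) M)) :
    (IsAdicSemidualizing R a M →
      ∀ (p : Ideal R) (hp : p.IsPrime), a ≤ p → IsAdicSemidualizingLocalizedAt R a M p hp) ∧
    (IsAdicSemidualizing R a M ↔
      ∀ (m : Ideal R) (hm : m.IsMaximal), a ≤ m →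
        IsAdicSemidualizingLocalizedAt R a M m hm.isPrime) := by
  letI : HasDerivedCategory (ModuleCat.{u} R) := HasDerivedCategory.standard _
  letI : ∀ S : Submonoid R, HasDerivedCategory (ModuleCat.{u} (Localization S)) :=
    fun S => HasDerivedCategory.standard _
  have key : IsAdicSemidualizing R a M →
      ∀ (p : Ideal R) (hp : p.IsPrime), a ≤ p → IsAdicSemidualizingLocalizedAt R a M p hp := by
    rintro ⟨_, _, h⟩ p hp hap
    have htor' := ASL.torsion_loc p.primeCompl a M htor
    refine ⟨htor', fun i => ?_, ?_⟩
    · exact ASL.ext_loc_finite p.primeCompl (ModuleCat.of R (R ⧸ a)) (ModuleCat.of R M)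
        (inferInstanceAs (Module.Finite R (R ⧸ a))) _ _ (ASL.quotLocIso p.primeCompl a)
        (ASL.locIso p.primeCompl (ModuleCat.of R M)) i (hfin i)
    · exact (ASL.SD_module _ _ htor').1
        (ASL.SD_forward p.primeCompl a M htor hfin ((ASL.SD_module a M htor).2 h))
  refine ⟨key, fun h m hm => key h m hm.isPrime, fun h => ⟨htor, hfin, ?_⟩⟩
  refine (ASL.SD_module a M htor).1 (ASL.SD_backward a M htor hfin fun m hm hma => ?_)
  have := hm.isPrime
  refine ⟨m.primeCompl, fun s hs => hs, HasDerivedCategory.standard _, ?_⟩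
  exact (ASL.SD_module _ _ (ASL.torsion_loc m.primeCompl a M htor)).2 (h m hm hma).2.2

end
end

section
/- Let R be a commutative noetherian ring, a a proper ideal, φ : R → S a faithfully flat homomorphism of noetherian rings with aS ≠ S, and M an R-module. Then M is a-adically semidualizing over R if and only if S ⊗_R M is aS-adically semidualizing over S, provided the induced map R̂^a → Ŝ^{aS} of completions is an isomorphism. -/
open CategoryTheory
open scoped TensorProduct

noncomputable section
universe u

section A
variable (R S : Type u) [CommRing R] [CommRing S] [Algebra R S]

theorem smul_homology_eq_zero {ι : Type} {c : ComplexShape ι} (K : HomologicalComplex (ModuleCat.{u} R) c) (i : ι) (x : R)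
    (φ : K ⟶ K) (hφ : φ = x • 𝟙 K)
    (h : HomologicalComplex.homologyMap φ i = 0) (y : K.homology i) : x • y = 0 := by
  obtain ⟨z, rfl⟩ := (ModuleCat.epi_iff_surjective (K.homologyπ i)).mp inferInstance y
  have h1 := HomologicalComplex.homologyπ_naturality φ i
  have h2 : HomologicalComplex.cyclesMap φ i = x • 𝟙 (K.cycles i) := by
    rw [← cancel_mono (K.iCycles i), HomologicalComplex.cyclesMap_i, hφ, HomologicalComplex.smul_f_apply,
      Linear.smul_comp, Linear.comp_smul]
    simp
  rw [h, h2, Limits.comp_zero] at h1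
  have h3 := (congrArg (fun g => g.hom z) h1).symm
  rw [← map_smul]
  exact h3

theorem ext_smul_eq_zero (i : ℕ) (M N : Type u) [AddCommGroup M] [Module R M]
    [AddCommGroup N] [Module R N] (x : R) (hx : ∀ m : M, x • m = 0) (e : extMod R i M N) :
    x • e = 0 := by
  let P := ProjectiveResolution.of (ModuleCat.of R M)
  let T := ((linearYoneda R (ModuleCat.{u} R)).obj (ModuleCat.of R N)).rightOp
  have h0 : Homotopy (x • 𝟙 P.complex) 0 := by
    apply ProjectiveResolution.liftHomotopyZero (P := P) (Q := P)
    have hM : x • 𝟙 (ModuleCat.of R M) = 0 := by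
      ext m
      exact hx m
    have h5 : P.π.f 0 ≫ (x • 𝟙 (ModuleCat.of R M)) = 0 := by
      rw [hM]; exact Limits.comp_zero
    ext m
    have h6 := congrArg (fun g => g.hom m) h5
    have h7 : (P.π.f 0).hom (x • m) = 0 := by
      rw [map_smul]; exact h6
    exact h7
  let h1 := T.mapHomotopy h0
  have h2 := (h1.unop).homologyMap_eq i
  have h3 : (HomologicalComplex.unopFunctor (ModuleCat R) (ComplexShape.down ℕ)).map
      (((T.mapHomologicalComplex _).map (x • 𝟙 P.complex)).op) =
      x • 𝟙 (P.complex.linearYonedaObj R (ModuleCat.of R N)) := by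
    ext n f
    apply ModuleCat.hom_ext
    ext p
    change f.hom (x • p) = x • f.hom p
    rw [map_smul]
  have h4 : ∀ y : (P.complex.linearYonedaObj R (ModuleCat.of R N)).homology i, x • y = 0 := by
    refine smul_homology_eq_zero R _ i x _ h3 (h2.trans ?_)
    rw [Functor.map_zero]
    exact HomologicalComplex.homologyMap_zero _ _ _
  let φ := (P.isoExt (R := R) i (ModuleCat.of R N)).toLinearEquiv
  apply φ.injective
  rw [map_smul, map_zero]
  exact h4 _

instance extAdd : (ModuleCat.extendScalars.{u,u,u} (algebraMap R S)).Additive :=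
  (ModuleCat.extendRestrictScalarsAdj (algebraMap R S)).left_adjoint_additive

instance : (ModuleCat.extendScalars.{u,u,u} (algebraMap R S)).PreservesProjectiveObjects where
  projective_obj := by
    intro X hX
    exact (ModuleCat.extendRestrictScalarsAdj (algebraMap R S)).map_projective X hX

instance extPH [Module.Flat R S] : (ModuleCat.extendScalars.{u,u,u} (algebraMap R S)).PreservesHomology := by
  have h := ModuleCat.preservesFiniteLimits_extendScalars_of_flat (f := algebraMap R S)
    (RingHom.flat_algebraMap_iff.mpr inferInstance)
  infer_instance

instance : (ModuleCat.restrictScalars.{u,u,u} (algebraMap R S)).PreservesHomology := inferInstance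

def mkModIso {R : Type u} [CommRing R] (A B : ModuleCat.{u} R) (e : A ≃+ B)
    (h : ∀ (r : R) (x : A), e (r • x) = r • e x) : A ≅ B :=
  (e.toLinearEquiv h).toModuleIso

def homIso (X : ModuleCat.{u} R) (N : ModuleCat.{u} S) :
    (ModuleCat.restrictScalars.{u,u,u} (algebraMap R S)).obj
      (ModuleCat.of S ((ModuleCat.extendScalars.{u,u,u} (algebraMap R S)).obj X ⟶ N)) ≅
    ModuleCat.of R (X ⟶ (ModuleCat.restrictScalars.{u,u,u} (algebraMap R S)).obj N) :=
  mkModIso _ _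
    { toFun := (ModuleCat.extendRestrictScalarsAdj (algebraMap R S)).homEquiv X N
      invFun := ((ModuleCat.extendRestrictScalarsAdj (algebraMap R S)).homEquiv X N).symm
      left_inv := ((ModuleCat.extendRestrictScalarsAdj (algebraMap R S)).homEquiv X N).left_inv
      right_inv := ((ModuleCat.extendRestrictScalarsAdj (algebraMap R S)).homEquiv X N).right_inv
      map_add' := by
        intro f g
        apply ModuleCat.hom_ext
        ext p
        rfl } (by
        intro r f
        apply ModuleCat.hom_ext
        ext p
        rfl )

def cxIso (P : ChainComplex (ModuleCat.{u} R) ℕ) (N : ModuleCat.{u} S) :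
  ((ModuleCat.restrictScalars.{u,u,u} (algebraMap R S)).mapHomologicalComplex _).obj
   (ChainComplex.linearYonedaObj (((ModuleCat.extendScalars.{u,u,u} (algebraMap R S)).mapHomologicalComplex _).obj P) S N)
   ≅ P.linearYonedaObj R ((ModuleCat.restrictScalars.{u,u,u} (algebraMap R S)).obj N) :=
  HomologicalComplex.Hom.isoOfComponents
    (fun n ↦ homIso R S (P.X n) N) (by
     intro i j hij
     ext f
     apply ModuleCat.hom_ext
     ext p
     rfl)

def extIso [Module.Flat R S] (n : ℕ) (X : ModuleCat.{u} R) (N : ModuleCat.{u} S) :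
   (ModuleCat.restrictScalars.{u,u,u} (algebraMap R S)).obj
    (((Ext S (ModuleCat.{u} S) n).obj (Opposite.op ((ModuleCat.extendScalars.{u,u,u} (algebraMap R S)).obj X))).obj N)
   ≅ ((Ext R (ModuleCat.{u} R) n).obj (Opposite.op X)).obj ((ModuleCat.restrictScalars.{u,u,u} (algebraMap R S)).obj N) :=
  (ModuleCat.restrictScalars.{u,u,u} (algebraMap R S)).mapIso
    ((((ModuleCat.extendScalars.{u,u,u} (algebraMap R S))).mapProjectiveResolution 
      (ProjectiveResolution.of X)).isoExt n N) ≪≫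
   ((HomologicalComplex.sc _ n).mapHomologyIso (ModuleCat.restrictScalars.{u,u,u} (algebraMap R S))).symm ≪≫
   (HomologicalComplex.homologyFunctor _ _ n).mapIso (cxIso R S (ProjectiveResolution.of X).complex N) ≪≫
   ((ProjectiveResolution.of X).isoExt n _).symm

theorem extIso' [Module.Flat R S] (n : ℕ) (M N : Type u) [AddCommGroup M] [Module R M]
    [AddCommGroup N] [Module R N] [Module S N] [IsScalarTower R S N] :
    ∃ e : extMod S n (S ⊗[R] M) N ≃+ extMod R n M N, ∀ (r : R) x, e (algebraMap R S r • x) = r • e x := by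
  have h1 : Nonempty (ModuleCat.of S (S ⊗[R] M) ≅
      (ModuleCat.extendScalars.{u,u,u} (algebraMap R S)).obj (ModuleCat.of R M)) := by
    rename_i i1 i2
    obtain ⟨f, rfl⟩ : ∃ f : R →+* S, ‹Algebra R S› = f.toAlgebra :=
      ⟨algebraMap R S, Algebra.algebra_ext _ _ fun r => rfl⟩
    exact ⟨Iso.refl _⟩
  obtain ⟨e1⟩ := h1
  have hN : ∀ (r : R) (x : N), algebraMap R S r • x = r • x := fun r x => algebraMap_smul S r x
  let e2 : (ModuleCat.restrictScalars.{u,u,u} (algebraMap R S)).obj (ModuleCat.of S N) ≅ ModuleCat.of R N :=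
    mkModIso _ _ (AddEquiv.refl N) hN
  let e3 := (ModuleCat.restrictScalars.{u,u,u} (algebraMap R S)).mapIso
    (((Ext S (ModuleCat.{u} S) n).mapIso e1.op.symm).app (ModuleCat.of S N)) ≪≫
    extIso R S n (ModuleCat.of R M) (ModuleCat.of S N) ≪≫
    ((Ext R (ModuleCat.{u} R) n).obj (Opposite.op (ModuleCat.of R M))).mapIso e2
  exact ⟨e3.toLinearEquiv.toAddEquiv, fun r x => e3.toLinearEquiv.map_smul r x⟩

end A

section B
variable {R S : Type u} [CommRing R] [CommRing S] [Algebra R S] (a : Ideal R)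

theorem dense_of_comp [IsNoetherianRing R]
    (hcomp : ∃ e : AdicCompletion a R ≃+* AdicCompletion (a.map (algebraMap R S)) S,
      ∀ r : R, e (algebraMap R (AdicCompletion a R) r) =
        algebraMap S (AdicCompletion (a.map (algebraMap R S)) S) (algebraMap R S r))
    (n : ℕ) (s : S) : ∃ r : R, s - algebraMap R S r ∈ (a.map (algebraMap R S)) ^ n := by
  generalize hb : a.map (algebraMap R S) = b at hcomp ⊢
  obtain ⟨e, he⟩ := hcomp
  set y := e.symm (algebraMap S _ s) with hy
  obtain ⟨r, hr⟩ := Submodule.mkQ_surjective _ (AdicCompletion.eval a R n y)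
  refine ⟨r, ?_⟩
  have h1 : AdicCompletion.eval a R n (y - algebraMap R _ r) = 0 := by
    rw [map_sub, ← hr, sub_eq_zero]
    rfl
  have h2 : y - algebraMap R _ r ∈ a ^ n • (⊤ : Submodule R (AdicCompletion a R)) := by
    rw [AdicCompletion.pow_smul_top_eq_ker_eval (IsNoetherian.noetherian a)]
    exact h1
  have h3 : ∀ z ∈ a ^ n • (⊤ : Submodule R (AdicCompletion a R)),
      AdicCompletion.evalₐ b n (e z) = 0 := by
    intro z hz
    refine Submodule.smul_induction_on hz ?_ ?_
    · intro r hr m _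
      rw [Algebra.smul_def, map_mul, he, map_mul]
      have : AdicCompletion.evalₐ b n (algebraMap S (AdicCompletion b S) (algebraMap R S r)) = 0 := by
        rw [AlgHom.commutes, Ideal.Quotient.algebraMap_eq, Ideal.Quotient.eq_zero_iff_mem, ← hb, ← Ideal.map_pow]
        exact Ideal.mem_map_of_mem _ hr
      rw [this, zero_mul]
    · intro x y hx hy
      rw [map_add, map_add, hx, hy, add_zero]
  have h4 := h3 _ h2
  rw [map_sub, he, hy, e.apply_symm_apply, ← map_sub, AlgHom.commutes, Ideal.Quotient.algebraMap_eq,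
    Ideal.Quotient.eq_zero_iff_mem] at h4
  exact h4

theorem torsion_iff [Module.FaithfullyFlat R S] (M : Type u) [AddCommGroup M] [Module R M] :
    IsAdicTorsion R a M ↔ IsAdicTorsion S (a.map (algebraMap R S)) (S ⊗[R] M) := by
  constructor
  · intro h x
    induction x with
    | zero => exact ⟨0, by simp⟩
    | tmul s m =>
      obtain ⟨n, hn⟩ := h m
      refine ⟨n, fun r hr => ?_⟩
      rw [← Ideal.map_pow] at hr
      refine Submodule.span_induction ?_ ?_ ?_ ?_ hr
      · rintro _ ⟨t, ht, rfl⟩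
        rw [algebraMap_smul, ← TensorProduct.tmul_smul, hn t ht, TensorProduct.tmul_zero]
      · simp
      · intro x y _ _ hx hy
        rw [add_smul, hx, hy, add_zero]
      · intro c x _ hx
        rw [smul_assoc, hx, smul_zero]
    | add x y hx hy =>
      obtain ⟨n, hn⟩ := hx
      obtain ⟨k, hk⟩ := hy
      refine ⟨n + k, fun r hr => ?_⟩
      rw [smul_add, hn r (Ideal.pow_le_pow_right (by omega) hr),
        hk r (Ideal.pow_le_pow_right (by omega) hr), add_zero]
  · intro h m
    obtain ⟨n, hn⟩ := h (1 ⊗ₜ m)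
    refine ⟨n, fun r hr => ?_⟩
    apply Module.FaithfullyFlat.tensorProduct_mk_injective (A := R) (B := S) M
    have := hn (algebraMap R S r) (by rw [← Ideal.map_pow]; exact Ideal.mem_map_of_mem _ hr)
    rw [algebraMap_smul] at this
    rw [map_smul, map_zero]
    exact this

theorem smul_eq_of_sub_mem {E : Type u} [AddCommGroup E] [Module S E] {s t : S} {n : ℕ} {x : E} 
   {b : Ideal S} (h : s - t ∈ b ^ n) (hx : ∀ r ∈ b ^ n, r • x = 0) : s • x = t • x := by
  rw [← sub_eq_zero, ← sub_smul]; exact hx _ h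

theorem mk_bijective [Module.FaithfullyFlat R S] (M : Type u) [AddCommGroup M] [Module R M]
    (hd : ∀ (n : ℕ) (s : S), ∃ r : R, s - algebraMap R S r ∈ (a.map (algebraMap R S)) ^ n)
    (hM : IsAdicTorsion R a M) : Function.Bijective (TensorProduct.mk R S M 1) := by
  refine ⟨Module.FaithfullyFlat.tensorProduct_mk_injective M, ?_⟩
  intro x
  induction x with
  | zero => exact ⟨0, by simp⟩
  | tmul s m =>
    obtain ⟨n, hn⟩ := (torsion_iff (S := S) a M).1 hM (1 ⊗ₜ m)
    obtain ⟨r, hr⟩ := hd n s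
    refine ⟨r • m, ?_⟩
    have := smul_eq_of_sub_mem hr hn
    rw [map_smul, TensorProduct.mk_apply, ← algebraMap_smul S r, ← this, TensorProduct.smul_tmul', smul_eq_mul, mul_one]
  | add x y hx hy =>
    obtain ⟨x, rfl⟩ := hx
    obtain ⟨y, rfl⟩ := hy
    exact ⟨x + y, map_add _ _ _⟩

/-- On torsion modules, every `R`-linear endomorphism is `S`-linear. -/
def linEquiv (N : Type u) [AddCommGroup N] [Module R N] [Module S N] [IsScalarTower R S N]
    (hd : ∀ (n : ℕ) (s : S), ∃ r : R, s - algebraMap R S r ∈ (a.map (algebraMap R S)) ^ n)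
    (hN : IsAdicTorsion S (a.map (algebraMap R S)) N) : Module.End S N ≃+* Module.End R N where
  toFun f := f.restrictScalars R
  invFun f :=
    { f with
      map_smul' := by
        intro s x
        obtain ⟨n, hn⟩ := hN x
        obtain ⟨m, hm⟩ := hN (f x)
        obtain ⟨r, hr⟩ := hd (n + m) s
        have h1 := smul_eq_of_sub_mem hr
          (fun t ht => hn t (Ideal.pow_le_pow_right (by omega) ht))
        have h2 := smul_eq_of_sub_mem hr
          (fun t ht => hm t (Ideal.pow_le_pow_right (by omega) ht))
        change f (s • x) = s • f x
        rw [h1, h2, algebraMap_smul, algebraMap_smul, map_smul] }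
  left_inv f := rfl
  right_inv f := rfl
  map_add' f g := rfl
  map_mul' f g := rfl

theorem end_iff [Module.FaithfullyFlat R S] (M : Type u) [AddCommGroup M] [Module R M]
    (hd : ∀ (n : ℕ) (s : S), ∃ r : R, s - algebraMap R S r ∈ (a.map (algebraMap R S)) ^ n)
    (hM : IsAdicTorsion R a M)
    (hcomp : ∃ e : AdicCompletion a R ≃+* AdicCompletion (a.map (algebraMap R S)) S,
      ∀ r : R, e (algebraMap R (AdicCompletion a R) r) =
        algebraMap S (AdicCompletion (a.map (algebraMap R S)) S) (algebraMap R S r)) :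
    (∃ χ : AdicCompletion a R →ₐ[R] Module.End R M, Function.Bijective χ) ↔
    (∃ χ : AdicCompletion (a.map (algebraMap R S)) S →ₐ[S] Module.End S (S ⊗[R] M),
      Function.Bijective χ) := by
  have hN := (torsion_iff (S := S) a M).1 hM
  let ε := LinearEquiv.ofBijective _ (mk_bijective a M hd hM)
  let L := linEquiv a (S ⊗[R] M) hd hN
  let C := ε.conjAlgEquiv R
  obtain ⟨e, he⟩ := hcomp
  constructor
  · rintro ⟨χ, hχ⟩
    let g : AdicCompletion (a.map (algebraMap R S)) S →+* Module.End S (S ⊗[R] M) :=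
      L.symm.toRingHom.comp (C.toRingEquiv.toRingHom.comp (χ.toRingHom.comp e.symm.toRingHom))
    have hg : ∀ z, g z = L.symm (C (χ (e.symm z))) := fun z => rfl
    have hgb : Function.Bijective g :=
      L.symm.bijective.comp (C.bijective.comp (hχ.comp e.symm.bijective))
    have hgr : ∀ (r : R) x, g (algebraMap S _ (algebraMap R S r)) x = r • x := by
      intro r x
      have h1 : L (g (algebraMap S _ (algebraMap R S r))) = algebraMap R _ r := by
        rw [hg, ← he, e.symm_apply_apply, L.apply_symm_apply, AlgHom.commutes, AlgEquiv.commutes]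
      exact congrArg (fun f : Module.End R (S ⊗[R] M) => f x) h1
    have hgt : ∀ (n : ℕ) (x : S ⊗[R] M), (∀ r ∈ (a.map (algebraMap R S)) ^ n, r • x = 0) →
        ∀ t ∈ (a.map (algebraMap R S)) ^ n, g (algebraMap S _ t) x = 0 := by
      intro n x hx t ht
      rw [← Ideal.map_pow] at ht hx
      refine Submodule.span_induction ?_ ?_ ?_ ?_ ht
      · rintro _ ⟨r, hr, rfl⟩
        rw [hgr, ← algebraMap_smul S r]
        exact hx _ (Ideal.mem_map_of_mem _ hr)
      · simp
      · intro y z _ _ hy hz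
        rw [map_add, map_add, LinearMap.add_apply, hy, hz, add_zero]
      · intro c y _ hy
        rw [smul_eq_mul, map_mul, map_mul, Module.End.mul_apply, hy, map_zero]
    refine ⟨{ g with commutes' := ?_ }, hgb⟩
    intro s
    apply LinearMap.ext
    intro x
    obtain ⟨n, hn⟩ := hN x
    obtain ⟨r, hr⟩ := hd n s
    have h1 := hgt n x hn _ hr
    rw [map_sub, map_sub, LinearMap.sub_apply, hgr, sub_eq_zero] at h1
    change g (algebraMap S _ s) x = s • x
    rw [h1, smul_eq_of_sub_mem hr hn, algebraMap_smul]
  · rintro ⟨χ, hχ⟩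
    let g : AdicCompletion a R →+* Module.End R M :=
      C.symm.toRingEquiv.toRingHom.comp (L.toRingHom.comp (χ.toRingHom.comp e.toRingHom))
    have hgb : Function.Bijective g :=
      C.symm.bijective.comp (L.bijective.comp (hχ.comp e.bijective))
    refine ⟨{ g with commutes' := ?_ }, hgb⟩
    intro r
    change C.symm (L (χ (e (algebraMap R _ r)))) = _
    rw [he, AlgHom.commutes, AlgEquiv.symm_apply_eq, AlgEquiv.commutes]
    apply LinearMap.ext
    intro x
    exact algebraMap_smul S r x

theorem finite_iff (E E' : Type u) [AddCommGroup E] [AddCommGroup E'] [Module S E] [Module R E']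
    (hd : ∀ (n : ℕ) (s : S), ∃ r : R, s - algebraMap R S r ∈ (a.map (algebraMap R S)) ^ n)
    (e : E ≃+ E') (he : ∀ (r : R) x, e (algebraMap R S r • x) = r • e x)
    (ha : ∀ r ∈ a, ∀ x : E', r • x = 0) : Module.Finite R E' ↔ Module.Finite S E := by
  letI : Module R E := Module.compHom E (algebraMap R S)
  haveI : IsScalarTower R S E := IsScalarTower.of_algebraMap_smul fun r x => rfl
  let e' : E ≃ₗ[R] E' := e.toLinearEquiv he
  rw [← Module.Finite.equiv_iff e']
  constructor
  · intro h
    exact Module.Finite.of_restrictScalars_finite R S E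
  · intro h
    have hb : ∀ t ∈ a.map (algebraMap R S), ∀ x : E, t • x = 0 := by
      intro t ht x
      refine Submodule.span_induction ?_ ?_ ?_ ?_ ht
      · rintro _ ⟨r, hr, rfl⟩
        apply e.injective
        rw [he, ha r hr, map_zero]
      · simp
      · intro y z _ _ hy hz
        rw [add_smul, hy, hz, add_zero]
      · intro c y _ hy
        rw [smul_assoc, hy, smul_zero]
    obtain ⟨s, hs⟩ := h
    refine ⟨s, ?_⟩
    rw [eq_top_iff]
    rintro x -
    have hx : x ∈ Submodule.span S (s : Set E) := by rw [hs]; trivial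
    refine Submodule.span_induction ?_ ?_ ?_ ?_ hx
    · intro y hy
      exact Submodule.subset_span hy
    · exact zero_mem _
    · intro y z _ _ hy hz
      exact add_mem hy hz
    · intro c y _ hy
      obtain ⟨r, hr⟩ := hd 1 c
      rw [pow_one] at hr
      have : c • y = r • y := by
        rw [← algebraMap_smul S r, ← sub_eq_zero, ← sub_smul]
        exact hb _ hr y
      rw [this]
      exact Submodule.smul_mem _ _ hy

def extCongr (T : Type u) [CommRing T] (i : ℕ) {M M' N N' : Type u} [AddCommGroup M] [Module T M] [AddCommGroup M']
   [Module T M'] [AddCommGroup N] [Module T N] [AddCommGroup N'] [Module T N']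
   (f : M ≃ₗ[T] M') (g : N ≃ₗ[T] N') : extMod T i M N ≃ₗ[T] extMod T i M' N' :=
  ((((Ext T (ModuleCat.{u} T) i).mapIso f.toModuleIso.op.symm).app _) ≪≫
    ((Ext T (ModuleCat.{u} T) i).obj _).mapIso g.toModuleIso).toLinearEquiv

end B

/-- Let `φ : R → S` be a faithfully flat homomorphism of commutative noetherian rings with
`aS ≠ S` and suppose that the induced map of completions `R̂^a → Ŝ^{aS}` is an isomorphism.
Then an `R`-module `M` is `a`-adically semidualizing over `R` if and only if `S ⊗_R M` is
`aS`-adically semidualizing over `S`. -/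
theorem baseChange_isAdicSemidualizing
    (R S : Type u) [CommRing R] [CommRing S] [IsNoetherianRing R] [IsNoetherianRing S]
    [Algebra R S] [Module.FaithfullyFlat R S]
    (a : Ideal R) (ha : a ≠ ⊤) (haS : a.map (algebraMap R S) ≠ ⊤)
    (hcomp : ∃ e : AdicCompletion a R ≃+* AdicCompletion (a.map (algebraMap R S)) S,
      ∀ r : R, e (algebraMap R (AdicCompletion a R) r) =
        algebraMap S (AdicCompletion (a.map (algebraMap R S)) S) (algebraMap R S r))
    (M : Type u) [AddCommGroup M] [Module R M] :
    IsAdicSemidualizing R a M ↔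
      IsAdicSemidualizing S (a.map (algebraMap R S)) (S ⊗[R] M) := by
  have hd := dense_of_comp a hcomp
  unfold IsAdicSemidualizing
  rw [← torsion_iff (S := S) a M]
  refine and_congr_right fun hM => ?_
  let ε := LinearEquiv.ofBijective _ (mk_bijective a M hd hM)
  rw [end_iff a M hd hM hcomp]
  refine and_congr (forall_congr' fun i => ?_) (and_congr_right fun _ =>
    forall_congr' fun i => imp_congr_right fun _ => ?_)
  · obtain ⟨e, he⟩ := extIso' R S i (R ⧸ a) (S ⊗[R] M)
    let q : (S ⧸ a.map (algebraMap R S)) ≃ₗ[S] S ⊗[R] (R ⧸ a) :=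
      (Algebra.TensorProduct.quotIdealMapEquivTensorQuot S a).toLinearEquiv
    rw [(Module.Finite.equiv_iff (extCongr S i q (LinearEquiv.refl S (S ⊗[R] M)))),
      (Module.Finite.equiv_iff (extCongr R i (LinearEquiv.refl R (R ⧸ a)) ε))]
    refine finite_iff a _ _ hd e he ?_
    intro r hr x
    apply ext_smul_eq_zero
    intro m
    obtain ⟨m, rfl⟩ := Ideal.Quotient.mk_surjective m
    rw [← Ideal.Quotient.mk_eq_mk, ← Submodule.Quotient.mk_smul, Submodule.Quotient.mk_eq_zero]
    exact Ideal.mul_mem_right _ _ hr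
  · obtain ⟨e, he⟩ := extIso' R S i M (S ⊗[R] M)
    rw [e.toEquiv.subsingleton_congr, (extCongr R i (LinearEquiv.refl R M) ε).toEquiv.subsingleton_congr]

end
end
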